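/- arXiv:math/9905010 — 7 statements merged into one kernel-verified Lean document; each statement's English description precedes it below -/
import Mathlib

section
/- For each index i (1 ≤ i ≤ r), the set (Δ ∖ {α_i}) ∪ {−θ} is a base of the root system Φ if and only if α_i is a long root and (λ_i, θ) = 1. -/
open scoped RealInnerProductSpace

noncomputable section

/-- An irreducible reduced crystallographic root system in a finite-dimensional real
inner product space, normalized so that long roots have squared length `2`, together
with a chosen base `α`, the half-sum `ρ` of the positive roots, the highest root `θ`,
and the fundamental weights `fw`. -/
structure RootSystemData (E : Type) [NormedAddCommGroup E] [InnerProductSpace ℝ E]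
    [FiniteDimensional ℝ E] : Type where
  Φ : Finset E
  r : ℕ
  α : Fin r → E
  ρ : E
  θ : E
  fw : Fin r → E
  nonzero : ∀ β ∈ Φ, β ≠ (0 : E)
  spans : Submodule.span ℝ (Φ : Set E) = ⊤
  reflect_mem : ∀ β ∈ Φ, ∀ γ ∈ Φ, γ - (2 * ⟪γ, β⟫ / ⟪β, β⟫) • β ∈ Φ
  integral : ∀ β ∈ Φ, ∀ γ ∈ Φ, ∃ n : ℤ, 2 * ⟪γ, β⟫ / ⟪β, β⟫ = (n : ℝ)
  reduced : ∀ β ∈ Φ, ∀ t : ℝ, t • β ∈ Φ → t = 1 ∨ t = -1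
  irred : ¬ ∃ Φ₁ Φ₂ : Finset E, Φ₁.Nonempty ∧ Φ₂.Nonempty ∧ Disjoint Φ₁ Φ₂ ∧
      (∀ β, β ∈ Φ ↔ β ∈ Φ₁ ∨ β ∈ Φ₂) ∧ ∀ a ∈ Φ₁, ∀ b ∈ Φ₂, ⟪a, b⟫ = 0
  long_le : ∀ β ∈ Φ, ⟪β, β⟫ ≤ 2
  long_exists : ∃ β ∈ Φ, ⟪β, β⟫ = 2
  base_mem : ∀ i, α i ∈ Φ
  base_indep : LinearIndependent ℝ α
  base_spans : Submodule.span ℝ (Set.range α) = ⊤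
  base_coeffs : ∀ β ∈ Φ, ∃ c : Fin r → ℤ, β = ∑ i, (c i : ℝ) • α i ∧
      ((∀ i, 0 ≤ c i) ∨ (∀ i, c i ≤ 0))
  ρ_def : ∃ P : Finset E,
      (∀ β, β ∈ P ↔ β ∈ Φ ∧ ∃ c : Fin r → ℕ, β = ∑ i, (c i : ℝ) • α i) ∧
      ρ = (2 : ℝ)⁻¹ • ∑ β ∈ P, β
  θ_mem : θ ∈ Φ
  θ_pos : ∃ c : Fin r → ℕ, θ = ∑ i, (c i : ℝ) • α i
  θ_highest : ∀ β ∈ Φ, ∃ c : Fin r → ℝ, (∀ i, 0 ≤ c i) ∧ θ - β = ∑ i, c i • α i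
  fw_def : ∀ i j, ⟪fw i, α j⟫ = if i = j then ⟪α j, α j⟫ / 2 else 0

variable {E : Type} [NormedAddCommGroup E] [InnerProductSpace ℝ E] [FiniteDimensional ℝ E]


/-- `B` is a base of the root system `D.Φ`: a vector-space basis of `E` such that every
root is a linear combination of `B` with coefficients that are all nonnegative integers
or all nonpositive integers. -/
def IsBase (D : RootSystemData E) (B : Finset E) : Prop :=
  LinearIndependent ℝ (fun b : ↥(B : Set E) => (b : E)) ∧ Submodule.span ℝ (B : Set E) = ⊤ ∧
    ∀ β ∈ D.Φ, ∃ c : E → ℤ, β = ∑ b ∈ B, (c b : ℝ) • b ∧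
      ((∀ b ∈ B, 0 ≤ c b) ∨ (∀ b ∈ B, c b ≤ 0))


namespace RootSystemData

/-- The vector-space basis given by the simple roots. -/
def bas (D : RootSystemData E) : Module.Basis (Fin D.r) ℝ E :=
  Module.Basis.mk D.base_indep D.base_spans.ge

/-- The `j`-th simple root coordinate. -/
def co (D : RootSystemData E) (j : Fin D.r) : E →ₗ[ℝ] ℝ := D.bas.coord j

lemma co_α (D : RootSystemData E) (j k : Fin D.r) :
    D.co j (D.α k) = if k = j then 1 else 0 := by
  have h : D.α k = D.bas k := by simp [bas]
  rw [h, co, Module.Basis.coord_apply, Module.Basis.repr_self, Finsupp.single_apply]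

lemma co_sum (D : RootSystemData E) (c : Fin D.r → ℝ) (j : Fin D.r) :
    D.co j (∑ k, c k • D.α k) = c j := by
  simp [map_sum, co_α]

lemma sum_co (D : RootSystemData E) (x : E) : ∑ k, D.co k x • D.α k = x := by
  have h : ∀ k, D.α k = D.bas k := fun k => by simp [bas]
  simp only [h, co, Module.Basis.coord_apply]
  exact D.bas.sum_repr x

lemma co_int (D : RootSystemData E) {β : E} (hβ : β ∈ D.Φ) :
    ∃ c : Fin D.r → ℤ, (∀ j, D.co j β = c j) ∧ ((∀ j, 0 ≤ c j) ∨ (∀ j, c j ≤ 0)) := by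
  obtain ⟨c, hc, h⟩ := D.base_coeffs β hβ
  exact ⟨c, fun j => by rw [hc]; exact D.co_sum (fun j => (c j : ℝ)) j, h⟩

lemma norm_pos (D : RootSystemData E) {β : E} (hβ : β ∈ D.Φ) : 0 < ⟪β, β⟫ :=
  real_inner_self_pos.2 (D.nonzero β hβ)

/-- Height. -/
def ht (D : RootSystemData E) : E →ₗ[ℝ] ℝ := ∑ j, D.co j

lemma ht_apply (D : RootSystemData E) (x : E) : D.ht x = ∑ j, D.co j x := by
  simp [ht]

lemma ht_α (D : RootSystemData E) (k : Fin D.r) : D.ht (D.α k) = 1 := by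
  simp [ht_apply, co_α]

lemma refl_data (D : RootSystemData E) {β γ : E} (hβ : β ∈ D.Φ) (hγ : γ ∈ D.Φ) :
    ∃ n : ℤ, (n : ℝ) * ⟪γ, γ⟫ = 2 * ⟪β, γ⟫ ∧ β - (n : ℝ) • γ ∈ D.Φ ∧
      ⟪β - (n : ℝ) • γ, β - (n : ℝ) • γ⟫ = ⟪β, β⟫ := by
  obtain ⟨n, hn⟩ := D.integral γ hγ β hβ
  have hp := D.norm_pos hγ
  have h1 := D.reflect_mem γ hγ β hβ
  rw [hn] at h1
  have h2 : (n : ℝ) * ⟪γ, γ⟫ = 2 * ⟪β, γ⟫ := by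
    rw [← hn]; field_simp
  refine ⟨n, h2, h1, ?_⟩
  simp only [inner_sub_left, inner_sub_right, real_inner_smul_left, real_inner_smul_right,
    real_inner_comm β γ]
  linear_combination (n : ℝ) * h2

lemma θ_co_le (D : RootSystemData E) {β : E} (hβ : β ∈ D.Φ) (j : Fin D.r) :
    D.co j β ≤ D.co j D.θ := by
  obtain ⟨c, hc, h⟩ := D.θ_highest β hβ
  have := congrArg (D.co j) h
  rw [co_sum, map_sub] at this
  linarith [hc j]

lemma θ_co (D : RootSystemData E) : ∃ m : Fin D.r → ℕ, ∀ j, D.co j D.θ = m j := by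
  obtain ⟨c, hc⟩ := D.θ_pos
  exact ⟨c, fun j => by conv_lhs => rw [hc]
                        exact D.co_sum (fun j => (c j : ℝ)) j⟩

lemma θ_long (D : RootSystemData E) : ⟪D.θ, D.θ⟫ = 2 := by
  classical
  obtain ⟨β₀, hβ₀, h₀⟩ := D.long_exists
  obtain ⟨β, hβ, hmax⟩ := Finset.exists_max_image (D.Φ.filter (fun β => ⟪β, β⟫ = 2)) D.ht
    ⟨β₀, Finset.mem_filter.2 ⟨hβ₀, h₀⟩⟩
  rw [Finset.mem_filter] at hβ
  obtain ⟨hβ, hl⟩ := hβ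
  have hdom : ∀ k, 0 ≤ ⟪D.α k, β⟫ := by
    intro k
    by_contra hneg
    push Not at hneg
    obtain ⟨n, hn, hmem, hnorm⟩ := D.refl_data hβ (D.base_mem k)
    have hp := D.norm_pos (D.base_mem k)
    have h1 := hmax (β - (n : ℝ) • D.α k) (by simp only [Finset.mem_filter]; exact ⟨hmem, hnorm.trans hl⟩)
    rw [map_sub, map_smul, ht_α, smul_eq_mul] at h1
    rw [real_inner_comm] at hneg
    have : (n : ℝ) * ⟪D.α k, D.α k⟫ < 0 := by linarith
    nlinarith
  obtain ⟨c, hc, h⟩ := D.θ_highest β hβ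
  have h2 : 0 ≤ ⟪D.θ - β, β⟫ := by
    rw [h, sum_inner]
    refine Finset.sum_nonneg fun k _ => ?_
    rw [real_inner_smul_left]
    exact mul_nonneg (hc k) (hdom k)
  rw [inner_sub_left, hl] at h2
  have h3 := real_inner_mul_inner_self_le D.θ β
  rw [hl] at h3
  have h4 := D.long_le D.θ D.θ_mem
  nlinarith

lemma coroot_int (D : RootSystemData E) (i : Fin D.r) (N : ℕ) : ∀ β ∈ D.Φ,
    (∀ j, 0 ≤ D.co j β) → D.ht β < N →
    ∃ d : ℤ, D.co i β * ⟪D.α i, D.α i⟫ = d * ⟪β, β⟫ := by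
  induction N with
  | zero =>
    intro β hβ h0 hN
    rw [ht_apply] at hN
    have := Finset.sum_nonneg (fun j (_ : j ∈ Finset.univ) => h0 j)
    simp at hN
    linarith
  | succ N ih =>
    intro β hβ h0 hN
    have hpos := D.norm_pos hβ
    have hex : ∃ k, 0 < ⟪β, D.α k⟫ := by
      by_contra hcon
      push Not at hcon
      have : ⟪β, β⟫ ≤ 0 := by
        conv_lhs => rw [← D.sum_co β]
        rw [sum_inner]
        refine Finset.sum_nonpos fun k _ => ?_
        rw [real_inner_smul_left, D.sum_co, real_inner_comm]
        exact mul_nonpos_of_nonneg_of_nonpos (h0 k) (hcon k)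
      linarith
    obtain ⟨k, hk⟩ := hex
    obtain ⟨n, hn, hmem, hnorm⟩ := D.refl_data hβ (D.base_mem k)
    obtain ⟨nn, hnn, -, -⟩ := D.refl_data (D.base_mem k) hβ
    have hp := D.norm_pos (D.base_mem k)
    have hnpos : 0 < n := by
      have : (0 : ℝ) < n := by
        by_contra hcon
        nlinarith
      exact_mod_cast this
    have hn1 : (1 : ℝ) ≤ n := by exact_mod_cast hnpos
    by_cases hsimple : ∀ j, j ≠ k → D.co j β = 0
    · have hb : β = D.co k β • D.α k := by
        conv_lhs => rw [← D.sum_co β]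
        rw [Finset.sum_eq_single k]
        · intro j _ hj
          rw [hsimple j hj, zero_smul]
        · simp
      have h1 : β = D.α k := by
        have := D.reduced _ (D.base_mem k) (D.co k β) (hb ▸ hβ)
        rcases this with h | h
        · rw [h, one_smul] at hb; exact hb
        · have := h0 k; linarith
      rw [h1, co_α]
      by_cases hki : k = i
      · subst hki; exact ⟨1, by simp⟩
      · exact ⟨0, by simp [hki]⟩
    · push Not at hsimple
      obtain ⟨j, hjk, hj⟩ := hsimple
      have hjpos : 0 < D.co j β := lt_of_le_of_ne (h0 j) (Ne.symm hj)
      set γ := β - (n : ℝ) • D.α k with hγ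
      have hcoγ : ∀ l, D.co l γ = D.co l β - n * (if k = l then 1 else 0) := by
        intro l
        rw [hγ, map_sub, map_smul, co_α, smul_eq_mul]
      have hγ0 : ∀ l, 0 ≤ D.co l γ := by
        obtain ⟨c, hc, h⟩ := D.co_int hmem
        rcases h with h | h
        · intro l
          rw [hc]
          exact_mod_cast h l
        · have h1 := h j
          have h2 := hc j
          rw [hcoγ, if_neg (Ne.symm hjk)] at h2
          have h3 : (c j : ℝ) ≤ 0 := by exact_mod_cast h1
          linarith
      have hht : D.ht γ < N := by
        rw [hγ, map_sub, map_smul, ht_α, smul_eq_mul]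
        push_cast at hN
        linarith
      obtain ⟨d, hd⟩ := ih γ hmem hγ0 hht
      rw [hnorm, hcoγ] at hd
      rw [real_inner_comm β (D.α k)] at hnn
      by_cases hki : k = i
      · subst hki
        refine ⟨d + nn, ?_⟩
        rw [if_pos rfl] at hd
        push_cast
        linear_combination hd + hn - hnn
      · refine ⟨d, ?_⟩
        rw [if_neg hki] at hd
        linear_combination hd

lemma long_of_one (D : RootSystemData E) (i : Fin D.r) (h : D.co i D.θ = 1) :
    ⟪D.α i, D.α i⟫ = 2 := by
  obtain ⟨m, hm⟩ := D.θ_co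
  obtain ⟨N, hN⟩ := exists_nat_gt (D.ht D.θ)
  obtain ⟨d, hd⟩ := D.coroot_int i N D.θ D.θ_mem (fun j => by rw [hm]; positivity) hN
  rw [h, D.θ_long, one_mul] at hd
  have h1 := D.long_le _ (D.base_mem i)
  have h2 := D.norm_pos (D.base_mem i)
  have h3 : (0 : ℝ) < d := by linarith
  have h4 : (d : ℝ) ≤ 1 := by linarith
  have h5 : d = 1 := by
    have : 0 < d := by exact_mod_cast h3
    have : d ≤ 1 := by exact_mod_cast h4
    omega
  rw [hd, h5]; norm_num

lemma fw_θ (D : RootSystemData E) (i : Fin D.r) :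
    ⟪D.fw i, D.θ⟫ = D.co i D.θ * (⟪D.α i, D.α i⟫ / 2) := by
  conv_lhs => rw [← D.sum_co D.θ]
  rw [inner_sum, Finset.sum_eq_single i]
  · rw [real_inner_smul_right, D.fw_def, if_pos rfl]
  · intro j _ hj
    rw [real_inner_smul_right, D.fw_def, if_neg (Ne.symm hj), mul_zero]
  · simp

lemma negθ_ne (D : RootSystemData E) (j : Fin D.r) : D.α j ≠ -D.θ := by
  intro h
  obtain ⟨m, hm⟩ := D.θ_co
  have := congrArg (D.co j) h
  rw [co_α, if_pos rfl, map_neg, hm] at this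
  have h2 : (0 : ℝ) ≤ m j := by positivity
  linarith

lemma base_sum [DecidableEq E] (D : RootSystemData E) (i : Fin D.r) (f : E → E) :
    ∑ b ∈ (Finset.univ.image D.α).erase (D.α i) ∪ {-D.θ}, f b =
      ∑ j ∈ Finset.univ.erase i, f (D.α j) + f (-D.θ) := by
  have hinj : Function.Injective D.α := D.base_indep.injective
  rw [← Finset.image_erase hinj, Finset.sum_union, Finset.sum_image, Finset.sum_singleton]
  · exact fun a _ b _ h => hinj h
  · rw [Finset.disjoint_singleton_right, Finset.mem_image]
    rintro ⟨j, -, hj⟩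
    exact D.negθ_ne j hj

lemma co_eq_one_of_base [DecidableEq E] (D : RootSystemData E) (i : Fin D.r)
    (h : IsBase D ((Finset.univ.image D.α).erase (D.α i) ∪ {-D.θ})) : D.co i D.θ = 1 := by
  obtain ⟨c, hc, -⟩ := h.2.2 _ (D.base_mem i)
  rw [D.base_sum i (fun b => (c b : ℝ) • b)] at hc
  have h1 := congrArg (D.co i) hc
  obtain ⟨m, hm⟩ := D.θ_co
  rw [map_add, map_sum, Finset.sum_eq_zero, co_α, if_pos rfl, map_smul, map_neg, hm,
    smul_eq_mul, zero_add] at h1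
  · have h2 : (1 : ℤ) = c (-D.θ) * -(m i : ℤ) := by exact_mod_cast h1
    have h3 : (m i : ℤ) ∣ 1 := ⟨- c (-D.θ), by linarith⟩
    have h4 : m i ∣ 1 := by exact_mod_cast h3
    rw [hm, Nat.dvd_one.1 h4, Nat.cast_one]
  · intro j hj
    rw [map_smul, co_α, if_neg (Finset.ne_of_mem_erase hj), smul_zero]

lemma base_of_co_eq_one [DecidableEq E] (D : RootSystemData E) (i : Fin D.r)
    (h : D.co i D.θ = 1) :
    IsBase D ((Finset.univ.image D.α).erase (D.α i) ∪ {-D.θ}) := by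
  have hinj : Function.Injective D.α := D.base_indep.injective
  obtain ⟨m, hm⟩ := D.θ_co
  have hmi : m i = 1 := by
    have := hm i
    rw [h] at this
    exact_mod_cast this.symm
  set B := (Finset.univ.image D.α).erase (D.α i) ∪ {-D.θ} with hB
  have hθB : -D.θ ∈ B := by simp [hB]
  have hαB : ∀ j, j ≠ i → D.α j ∈ B := by
    intro j hj
    simp [hB, hinj.eq_iff, hj]
  have hθ : D.θ = ∑ j ∈ Finset.univ.erase i, (m j : ℝ) • D.α j + D.α i := by
    conv_lhs => rw [← D.sum_co D.θ]
    rw [← Finset.sum_erase_add _ _ (Finset.mem_univ i)]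
    simp [hm, hmi]
  have hspan : Submodule.span ℝ (B : Set E) = ⊤ := by
    rw [eq_top_iff, ← D.base_spans, Submodule.span_le]
    have hj : ∀ j, j ≠ i → D.α j ∈ Submodule.span ℝ (B : Set E) :=
      fun j hj => Submodule.subset_span (Finset.mem_coe.2 (hαB j hj))
    rintro _ ⟨j, rfl⟩
    by_cases hji : j = i
    · subst hji
      have h1 : D.α j = -(-D.θ) - ∑ k ∈ Finset.univ.erase j, (m k : ℝ) • D.α k := by
        rw [neg_neg, eq_sub_iff_add_eq]; conv_rhs => rw [hθ]
        rw [add_comm]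
      rw [h1]
      refine Submodule.sub_mem _ (Submodule.neg_mem _ (Submodule.subset_span (Finset.mem_coe.2 hθB))) ?_
      exact Submodule.sum_mem _ fun k hk => Submodule.smul_mem _ _ (hj k (Finset.ne_of_mem_erase hk))
    · exact hj j hji
  have hcard : B.card = D.r := by
    have hd : Disjoint ((Finset.univ.erase i).image D.α) {-D.θ} := by
      rw [Finset.disjoint_singleton_right, Finset.mem_image]
      rintro ⟨j, -, hj⟩
      exact D.negθ_ne j hj
    rw [hB, ← Finset.image_erase hinj, Finset.card_union_of_disjoint hd,
      Finset.card_image_of_injective _ hinj, Finset.card_erase_of_mem (Finset.mem_univ i)]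
    have := i.pos
    simp
    omega
  refine ⟨?_, hspan, ?_⟩
  · apply linearIndependent_of_top_le_span_of_card_eq_finrank
    · simp [hspan]
    · rw [Module.finrank_eq_card_basis D.bas]
      simp [hcard]
  · intro β hβ
    obtain ⟨c, hc, hsign⟩ := D.co_int hβ
    refine ⟨Function.extend D.α (fun j => c j - c i * m j) (fun _ => - c i), ?_, ?_⟩
    · rw [D.base_sum i (fun b => ((Function.extend D.α (fun j => c j - c i * (m j : ℤ))
        (fun _ => - c i) b : ℤ) : ℝ) • b)]
      simp only [hinj.extend_apply]
      rw [Function.extend_apply' _ _ _ (by rintro ⟨j, hj⟩; exact D.negθ_ne j hj)]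
      conv_lhs => rw [← D.sum_co β, ← Finset.sum_erase_add _ _ (Finset.mem_univ i)]
      conv_rhs => rw [hθ]
      push_cast
      simp only [hc, sub_smul, Finset.sum_sub_distrib, mul_smul, ← Finset.smul_sum]
      module
    · have hle : ∀ j, c j ≤ m j := by
        intro j
        have := D.θ_co_le hβ j
        rw [hc, hm] at this
        exact_mod_cast this
      have hneg : ∀ j, -c j ≤ m j := by
        intro j
        obtain ⟨n, hn, hmem, -⟩ := D.refl_data hβ hβ
        have hn2 : (n : ℝ) = 2 := mul_right_cancel₀ (D.norm_pos hβ).ne' hn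
        have := D.θ_co_le hmem j
        rw [hn2, map_sub, map_smul, smul_eq_mul, hc, hm] at this
        have h2 : -(c j : ℝ) ≤ m j := by linarith
        exact_mod_cast h2
      have hiff : ∀ P : ℤ → Prop, (∀ j, j ≠ i → P (c j - c i * m j)) → P (-c i) → ∀ b ∈ B,
          P (Function.extend D.α (fun j => c j - c i * m j) (fun _ => - c i) b) := by
        intro P h1 h2 b hb
        rw [hB, Finset.mem_union, Finset.mem_erase, Finset.mem_image, Finset.mem_singleton] at hb
        rcases hb with ⟨hne, j, -, rfl⟩ | rfl
        · rw [hinj.extend_apply]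
          exact h1 j (fun hji => hne (by rw [hji]))
        · rwa [Function.extend_apply' _ _ _ (by rintro ⟨j, hj⟩; exact D.negθ_ne j hj)]
      have hi1 := hle i
      have hi2 := hneg i
      rw [hmi] at hi1 hi2
      have hcases : c i = 0 ∨ c i = 1 ∨ c i = -1 := by push_cast at hi1 hi2; omega
      rcases hcases with h0 | h0 | h0
      · rcases hsign with hs | hs
        · left
          exact hiff (fun x => 0 ≤ x) (fun j _ => by have := hs j; simp [h0, this]) (by simp [h0])
        · right
          exact hiff (fun x => x ≤ 0) (fun j _ => by have := hs j; simp [h0, this]) (by simp [h0])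
      · right
        exact hiff (fun x => x ≤ 0) (fun j _ => by have := hle j; rw [h0]; linarith)
          (by simp [h0])
      · left
        exact hiff (fun x => 0 ≤ x) (fun j _ => by have := hneg j; rw [h0]; linarith)
          (by simp [h0])

end RootSystemData

/-- `(Δ ∖ {αᵢ}) ∪ {−θ}` is a base of `Φ` iff `αᵢ` is a long root and `(λᵢ, θ) = 1`. -/
theorem statement0 [DecidableEq E] (D : RootSystemData E) (i : Fin D.r) :
    IsBase D ((Finset.univ.image D.α).erase (D.α i) ∪ {-D.θ}) ↔
      ⟪D.α i, D.α i⟫ = 2 ∧ ⟪D.fw i, D.θ⟫ = 1 := by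
  constructor
  · intro h
    have h1 := D.co_eq_one_of_base i h
    have h2 := D.long_of_one i h1
    exact ⟨h2, by rw [D.fw_θ, h1, h2]; norm_num⟩
  · rintro ⟨h1, h2⟩
    rw [D.fw_θ, h1] at h2
    exact D.base_of_co_eq_one i (by linarith)
end
end

section
/- Let k > 0 be a real number, define φ_i : E → E by φ_i(γ) = kλ_i + τ_i(γ), and let S_k = {x ∈ E : (x, α_j) ≥ 0 for all 1 ≤ j ≤ r and (x, θ) ≤ k}. Then φ_i restricts to a bijection of S_k onto itself; equivalently, for every γ ∈ E, γ ∈ S_k if and only if φ_i(γ) ∈ S_k. -/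
open scoped RealInnerProductSpace

noncomputable section

variable {E : Type} [NormedAddCommGroup E] [InnerProductSpace ℝ E] [FiniteDimensional ℝ E]

/-- The Weyl group: the subgroup of linear automorphisms of `E` generated by the
reflections in the roots (each such reflection is automatically orthogonal). -/
def weylGroup (D : RootSystemData E) : Subgroup (E ≃ₗ[ℝ] E) :=
  Subgroup.closure {f | ∃ β ∈ D.Φ, ∀ x, f x = x - (2 * ⟪x, β⟫ / ⟪β, β⟫) • β}


theorem weyl_props (D : RootSystemData E) (τ : E ≃ₗ[ℝ] E) (h : τ ∈ weylGroup D) :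
    (∀ x y, ⟪τ x, τ y⟫ = ⟪x, y⟫) ∧ (∀ β, β ∈ D.Φ → τ β ∈ D.Φ) := by
  have refl : ∀ f : E ≃ₗ[ℝ] E, ∀ β ∈ D.Φ, (∀ x, f x = x - (2 * ⟪x, β⟫ / ⟪β, β⟫) • β) →
      (∀ x y, ⟪f x, f y⟫ = ⟪x, y⟫) ∧ (∀ β, β ∈ D.Φ → f β ∈ D.Φ) := by
    intro f β hβ hf
    have hne : ⟪β, β⟫ ≠ 0 := inner_self_ne_zero.mpr (D.nonzero β hβ)
    refine ⟨fun x y => ?_, fun γ hγ => ?_⟩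
    · rw [hf, hf]
      simp only [inner_sub_left, inner_sub_right, real_inner_smul_left, real_inner_smul_right]
      rw [real_inner_comm y β]
      field_simp
      ring
    · rw [hf]
      exact D.reflect_mem β hβ γ hγ
  unfold weylGroup at h
  induction h using Subgroup.closure_induction with
  | mem f hf =>
    obtain ⟨β, hβ, hf⟩ := hf
    exact refl f β hβ hf
  | one => exact ⟨fun x y => rfl, fun β hβ => hβ⟩
  | mul f g _ _ hf hg =>
    refine ⟨fun x y => ?_, fun β hβ => ?_⟩
    · rw [LinearEquiv.mul_apply, LinearEquiv.mul_apply, hf.1, hg.1]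
    · rw [LinearEquiv.mul_apply]
      exact hf.2 _ (hg.2 _ hβ)
  | inv f _ hf =>
    have hinv : ∀ x, f (f⁻¹ x) = x := fun x => f.apply_symm_apply x
    refine ⟨fun x y => ?_, fun β hβ => ?_⟩
    · rw [← hf.1, hinv, hinv]
    · have hsurj := Finset.surj_on_of_inj_on_of_card_le (s := D.Φ) (t := D.Φ)
        (fun a _ => f a) (fun a ha => hf.2 a ha) (fun a b _ _ hab => f.injective hab) le_rfl
      obtain ⟨a, ha, hab⟩ := hsurj β hβ
      have : f⁻¹ β = a := by
        apply f.injective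
        rw [hinv, hab]
      rw [this]
      exact ha

theorem tau_theta (D : RootSystemData E)
    (i : Fin D.r) (hlong : ⟪D.α i, D.α i⟫ = 2) (hθ1 : ⟪D.fw i, D.θ⟫ = 1)
    (τ : E ≃ₗ[ℝ] E) (hτW : τ ∈ weylGroup D)
    (hτi : τ (D.α i) = -D.θ)
    (hτj : ∀ j, j ≠ i → ∃ j', j' ≠ i ∧ τ (D.α j) = D.α j') : τ D.θ = - D.α i := by
  obtain ⟨c, hc⟩ := D.θ_pos
  have hci : (c i : ℝ) = 1 := by
    rw [hc, inner_sum] at hθ1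
    simp only [real_inner_smul_right, D.fw_def, mul_ite, mul_zero, Finset.sum_ite_eq,
      Finset.mem_univ, if_true, hlong] at hθ1
    linarith
  obtain ⟨d, hd, hsign⟩ := D.base_coeffs _ ((weyl_props D τ hτW).2 _ D.θ_mem)
  let b := Module.Basis.mk D.base_indep D.base_spans.ge
  have hb : ∀ j l, b.coord l (D.α j) = if j = l then 1 else 0 := by
    intro j l
    have : D.α j = b j := by simp [b]
    rw [this, Module.Basis.coord_apply, Module.Basis.repr_self, Finsupp.single_apply]
  let ht : E →ₗ[ℝ] ℝ := ∑ l, b.coord l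
  have hht : ∀ j, ht (D.α j) = 1 := by
    intro j
    simp only [ht, LinearMap.sum_apply, hb]
    simp
  have key : ∀ L : E →ₗ[ℝ] ℝ, L (τ D.θ) = - L D.θ +
      ∑ j ∈ Finset.univ.erase i, (c j : ℝ) * L (τ (D.α j)) := by
    intro L
    have h1 : L (τ D.θ) = ∑ j, (c j : ℝ) * L (τ (D.α j)) := by
      conv_lhs => rw [hc]
      simp [map_sum]
    rw [h1, ← Finset.add_sum_erase _ _ (Finset.mem_univ i), hτi, hci]
    simp
  have hdi : (d i : ℝ) = -1 := by
    have h := key (b.coord i)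
    have h0 : ∑ j ∈ Finset.univ.erase i, (c j : ℝ) * b.coord i (τ (D.α j)) = 0 := by
      apply Finset.sum_eq_zero
      intro j hj
      obtain ⟨j', hj', he⟩ := hτj j (Finset.ne_of_mem_erase hj)
      rw [he, hb, if_neg hj', mul_zero]
    rw [h0, hd, hc, map_sum, map_sum] at h
    simp only [map_smul, hb, smul_eq_mul, mul_ite, mul_one, mul_zero] at h
    simpa [hci] using h
  have hdsum : ∑ j, (d j : ℝ) = -1 := by
    have h := key ht
    have h0 : ∑ j ∈ Finset.univ.erase i, (c j : ℝ) * ht (τ (D.α j)) =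
        ∑ j ∈ Finset.univ.erase i, (c j : ℝ) := by
      apply Finset.sum_congr rfl
      intro j hj
      obtain ⟨j', hj', he⟩ := hτj j (Finset.ne_of_mem_erase hj)
      rw [he, hht, mul_one]
    rw [h0, hd, hc, map_sum, map_sum] at h
    simp only [map_smul, hht, smul_eq_mul, mul_one] at h
    rw [h, ← Finset.add_sum_erase _ _ (Finset.mem_univ i), hci]
    ring
  have hneg : ∀ j, d j ≤ 0 := by
    rcases hsign with h | h
    · have h2 : (0 : ℝ) ≤ d i := by exact_mod_cast h i
      linarith
    · exact h
  have hz : ∑ j ∈ Finset.univ.erase i, (d j : ℝ) = 0 := by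
    rw [← Finset.add_sum_erase _ _ (Finset.mem_univ i)] at hdsum
    linarith
  have hz' := (Finset.sum_eq_zero_iff_of_nonpos
    (fun j _ => by exact_mod_cast hneg j)).1 hz
  rw [hd, ← Finset.add_sum_erase _ _ (Finset.mem_univ i), hdi, Finset.sum_eq_zero]
  · simp
  · intro j hj
    rw [hz' j hj, zero_smul]

/-- For `k > 0`, the map `φᵢ(γ) = kλᵢ + τᵢ(γ)` restricts to a bijection of the simplex
`S_k = {x : (x,αⱼ) ≥ 0 for all j, (x,θ) ≤ k}` onto itself; equivalently `γ ∈ S_k` iff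
`φᵢ(γ) ∈ S_k`. -/
theorem statement2 (D : RootSystemData E)
    (i : Fin D.r) (hlong : ⟪D.α i, D.α i⟫ = 2) (hθ1 : ⟪D.fw i, D.θ⟫ = 1)
    (τ : E ≃ₗ[ℝ] E) (hτW : τ ∈ weylGroup D)
    (hτi : τ (D.α i) = -D.θ)
    (hτj : ∀ j, j ≠ i → ∃ j', j' ≠ i ∧ τ (D.α j) = D.α j')
    (k : ℝ) (hk : 0 < k) (Sk : Set E)
    (hSk : Sk = {x : E | (∀ j, 0 ≤ ⟪x, D.α j⟫) ∧ ⟪x, D.θ⟫ ≤ k}) :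
    Set.BijOn (fun γ : E => k • D.fw i + τ γ) Sk Sk ∧
      ∀ γ : E, γ ∈ Sk ↔ k • D.fw i + τ γ ∈ Sk := by
  obtain ⟨hiso, -⟩ := weyl_props D τ hτW
  have hθ := tau_theta D i hlong hθ1 τ hτW hτi hτj
  have hsurj : ∀ j', j' ≠ i → ∃ j, j ≠ i ∧ τ (D.α j) = D.α j' := by
    choose! σ hσ hσ' using hτj
    let s : Finset (Fin D.r) := Finset.univ.erase i
    intro j' hj'
    have hs := Finset.surj_on_of_inj_on_of_card_le (s := s) (t := s)
      (fun a _ => σ a) (fun a ha => by simpa [s] using hσ a (Finset.ne_of_mem_erase ha))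
      (fun a b ha hb hab => by
        have hab' : σ a = σ b := hab
        apply D.base_indep.injective
        apply τ.injective
        rw [hσ' a (Finset.ne_of_mem_erase ha), hσ' b (Finset.ne_of_mem_erase hb), hab'])
      le_rfl
    obtain ⟨j, hj, he⟩ := hs j' (by simp [s, hj'])
    exact ⟨j, Finset.ne_of_mem_erase hj, by rw [hσ' j (Finset.ne_of_mem_erase hj), he]⟩
  have e1 : ∀ γ, ⟪k • D.fw i + τ γ, D.θ⟫ = k - ⟪γ, D.α i⟫ := by
    intro γ
    have h : ⟪τ γ, D.θ⟫ = - ⟪γ, D.α i⟫ := by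
      rw [← hiso γ, hτi, inner_neg_right, neg_neg]
    rw [inner_add_left, real_inner_smul_left, hθ1, h]
    ring
  have e2 : ∀ γ, ⟪k • D.fw i + τ γ, D.α i⟫ = k - ⟪γ, D.θ⟫ := by
    intro γ
    have h : ⟪τ γ, D.α i⟫ = - ⟪γ, D.θ⟫ := by
      rw [← hiso γ, hθ, inner_neg_right, neg_neg]
    rw [inner_add_left, real_inner_smul_left, D.fw_def, if_pos rfl, hlong, h]
    ring
  have e3 : ∀ γ j j', j' ≠ i → τ (D.α j) = D.α j' →
      ⟪k • D.fw i + τ γ, D.α j'⟫ = ⟪γ, D.α j⟫ := by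
    intro γ j j' hj' he
    rw [inner_add_left, real_inner_smul_left, D.fw_def, if_neg hj'.symm, ← he, hiso]
    ring
  have hiff : ∀ γ : E, γ ∈ Sk ↔ k • D.fw i + τ γ ∈ Sk := by
    intro γ
    rw [hSk, Set.mem_setOf_eq, Set.mem_setOf_eq, e1]
    constructor
    · rintro ⟨h1, h2⟩
      refine ⟨fun j' => ?_, by linarith [h1 i]⟩
      by_cases hj' : j' = i
      · rw [hj', e2]
        linarith
      · obtain ⟨j, -, he⟩ := hsurj j' hj'
        rw [e3 γ j j' hj' he]
        exact h1 j
    · rintro ⟨h1, h2⟩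
      have h3 := h1 i
      rw [e2] at h3
      refine ⟨fun j => ?_, by linarith⟩
      by_cases hj : j = i
      · rw [hj]
        linarith
      · obtain ⟨j', hj', he⟩ := hτj j hj
        rw [← e3 γ j j' hj' he]
        exact h1 j'
  refine ⟨⟨fun γ hγ => (hiff γ).1 hγ, fun x _ y _ hxy => ?_, fun y hy => ?_⟩, hiff⟩
  · exact τ.injective (add_left_cancel hxy)
  · have he : k • D.fw i + τ (τ.symm (y - k • D.fw i)) = y := by
      rw [τ.apply_symm_apply]
      abel
    refine ⟨τ.symm (y - k • D.fw i), ?_, he⟩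
    rw [hiff, he]
    exact hy
end
end

section
/- τ_i(λ_i) = −λ_i; equivalently, τ_i^{−1}(λ_i) = −λ_i. -/
open scoped RealInnerProductSpace

noncomputable section

variable {E : Type} [NormedAddCommGroup E] [InnerProductSpace ℝ E] [FiniteDimensional ℝ E]

theorem weyl_inner (D : RootSystemData E) (τ : E ≃ₗ[ℝ] E) (h : τ ∈ weylGroup D) :
    ∀ x y : E, ⟪τ x, τ y⟫ = ⟪x, y⟫ := by
  unfold weylGroup at h
  induction h using Subgroup.closure_induction with
  | mem f hf =>
    obtain ⟨β, hβ, hf⟩ := hf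
    intro x y
    have hb : ⟪β, β⟫ ≠ 0 := inner_self_ne_zero.mpr (D.nonzero β hβ)
    rw [hf, hf]
    simp only [inner_sub_left, inner_sub_right, real_inner_smul_left, real_inner_smul_right]
    rw [real_inner_comm y β]
    field_simp
    ring
  | one => intro x y; rfl
  | mul f g _ _ hf hg =>
    intro x y
    simp only [LinearEquiv.mul_apply]
    rw [hf, hg]
  | inv f _ hf =>
    intro x y
    rw [← hf (f⁻¹ x) (f⁻¹ y)]
    have e : ∀ z, f (f⁻¹ z) = z := fun z => f.apply_symm_apply z
    rw [e, e]

/-- `τᵢ(λᵢ) = −λᵢ`; equivalently `τᵢ⁻¹(λᵢ) = −λᵢ`. -/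
theorem statement3 (D : RootSystemData E)
    (i : Fin D.r) (hlong : ⟪D.α i, D.α i⟫ = 2) (hθ1 : ⟪D.fw i, D.θ⟫ = 1)
    (τ : E ≃ₗ[ℝ] E) (hτW : τ ∈ weylGroup D)
    (hτi : τ (D.α i) = -D.θ)
    (hτj : ∀ j, j ≠ i → ∃ j', j' ≠ i ∧ τ (D.α j) = D.α j')
 :
    τ (D.fw i) = -(D.fw i) ∧ τ.symm (D.fw i) = -(D.fw i) := by
  have hin := weyl_inner D τ hτW
  have key : τ (D.fw i) = -(D.fw i) := by
    have hoth : ∀ k, k ≠ i → ⟪τ (D.fw i) + D.fw i, D.α k⟫ = 0 := by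
      choose g hg1 hg2 using hτj
      let G : {j // j ≠ i} → {j // j ≠ i} := fun j => ⟨g j.1 j.2, hg1 j.1 j.2⟩
      have hGi : Function.Injective G := by
        intro a b hab
        have h1 : g a.1 a.2 = g b.1 b.2 := congrArg Subtype.val hab
        have h2 : τ (D.α a.1) = τ (D.α b.1) := by rw [hg2 a.1 a.2, hg2 b.1 b.2, h1]
        exact Subtype.ext (D.base_indep.injective (τ.injective h2))
      have hGs : Function.Surjective G := Finite.surjective_of_injective hGi
      intro k hk
      obtain ⟨⟨j, hj⟩, hjk⟩ := hGs ⟨k, hk⟩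
      have h1 : g j hj = k := congrArg Subtype.val hjk
      have h2 : ⟪τ (D.fw i), D.α k⟫ = 0 := by
        rw [← h1, ← hg2 j hj, hin, D.fw_def, if_neg (Ne.symm hj)]
      rw [inner_add_left, h2, D.fw_def, if_neg (Ne.symm hk), add_zero]
    have hth : ⟪τ (D.fw i) + D.fw i, D.θ⟫ = 0 := by
      have h1 : ⟪τ (D.fw i), -D.θ⟫ = 1 := by
        rw [← hτi, hin, D.fw_def, if_pos rfl, hlong]; norm_num
      rw [inner_neg_right] at h1
      rw [inner_add_left, hθ1]; linarith
    obtain ⟨c, hc⟩ := D.θ_pos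
    have hexp : ∀ v : E, (∀ k, k ≠ i → ⟪v, D.α k⟫ = 0) →
        ⟪v, D.θ⟫ = (c i : ℝ) * ⟪v, D.α i⟫ := by
      intro v hv
      rw [hc, inner_sum, Finset.sum_eq_single i]
      · rw [real_inner_smul_right]
      · intro k _ hk
        rw [real_inner_smul_right, hv k hk, mul_zero]
      · intro h; exact absurd (Finset.mem_univ i) h
    have hci : (c i : ℝ) = 1 := by
      have := hexp (D.fw i) (fun k hk => by rw [D.fw_def, if_neg (Ne.symm hk)])
      rw [hθ1, D.fw_def, if_pos rfl, hlong] at this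
      linarith
    have hi0 : ⟪τ (D.fw i) + D.fw i, D.α i⟫ = 0 := by
      have := hexp _ hoth
      rw [hth, hci] at this
      linarith
    have hall : ∀ x ∈ Submodule.span ℝ (Set.range D.α), ⟪τ (D.fw i) + D.fw i, x⟫ = 0 := by
      intro x hx
      induction hx using Submodule.span_induction with
      | mem x hx =>
        obtain ⟨k, rfl⟩ := hx
        by_cases hk : k = i
        · rw [hk]; exact hi0
        · exact hoth k hk
      | zero => exact inner_zero_right _
      | add x y _ _ hx hy => rw [inner_add_right, hx, hy, add_zero]
      | smul a x _ hx => rw [real_inner_smul_right, hx, mul_zero]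
    have h0 := hall (τ (D.fw i) + D.fw i) (by rw [D.base_spans]; trivial)
    exact eq_neg_of_add_eq_zero_left (inner_self_eq_zero.mp h0)
  refine ⟨key, ?_⟩
  rw [LinearEquiv.symm_apply_eq, map_neg, key, neg_neg]
end
end

section
/- For every γ ∈ E one has (ρ, γ − τ_i(γ)) = h·(λ_i, γ). Equivalently, ρ − τ_i^{−1}(ρ) = h·λ_i; moreover also ρ − τ_i(ρ) = h·λ_i. -/
open scoped RealInnerProductSpace

noncomputable section

variable {E : Type} [NormedAddCommGroup E] [InnerProductSpace ℝ E] [FiniteDimensional ℝ E]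

theorem pos_reflect (D : RootSystemData E) (j : Fin D.r) (β : E) (hβ : β ∈ D.Φ)
    (hpos : ∃ c : Fin D.r → ℕ, β = ∑ i, (c i : ℝ) • D.α i) (hne : β ≠ D.α j) (t : ℝ)
    (ht : β - t • D.α j ∈ D.Φ) :
    (∃ c : Fin D.r → ℕ, β - t • D.α j = ∑ i, (c i : ℝ) • D.α i) ∧ β - t • D.α j ≠ D.α j := by
  classical
  obtain ⟨c, hc⟩ := hpos
  have key : ∀ f g : Fin D.r → ℝ, ∑ i, f i • D.α i = ∑ i, g i • D.α i → ∀ k, f k = g k := by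
    intro f g h k
    have h0 : ∑ i, (f i - g i) • D.α i = 0 := by
      simp only [sub_smul, Finset.sum_sub_distrib, h, sub_self]
    have := Fintype.linearIndependent_iff.1 D.base_indep _ h0 k
    linarith
  have single : ∀ x : ℝ, x • D.α j = ∑ i, (if i = j then x else 0) • D.α i := by
    intro x; simp [ite_smul]
  have hk : ∃ k, k ≠ j ∧ c k ≠ 0 := by
    by_contra hcon
    push Not at hcon
    have hb : β = (c j : ℝ) • D.α j := by
      rw [hc]
      refine Finset.sum_eq_single j (fun b _ hb => ?_) (fun h => absurd (Finset.mem_univ j) h)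
      simp [hcon b hb]
    rcases D.reduced _ (D.base_mem j) (c j) (hb ▸ hβ) with h | h
    · exact hne (by rw [hb, h, one_smul])
    · have : (0:ℝ) ≤ c j := Nat.cast_nonneg _
      linarith
  obtain ⟨k, hkj, hck⟩ := hk
  have hsub : β - t • D.α j = ∑ i, ((c i : ℝ) - if i = j then t else 0) • D.α i := by
    simp only [sub_smul, Finset.sum_sub_distrib, ← single, ← hc]
  have hckpos : (0:ℝ) < c k := by exact_mod_cast Nat.pos_of_ne_zero hck
  constructor
  · obtain ⟨d, hd, hs⟩ := D.base_coeffs _ ht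
    have hdk := key _ _ (hsub.symm.trans hd) k
    simp only [hkj, if_false, sub_zero] at hdk
    have hdpos : 0 < d k := by
      have : (0:ℝ) < d k := hdk ▸ hckpos
      exact_mod_cast this
    rcases hs with hs | hs
    · refine ⟨fun i => (d i).toNat, ?_⟩
      rw [hd]
      refine Finset.sum_congr rfl fun i _ => ?_
      congr 1
      have := Int.toNat_of_nonneg (hs i)
      exact_mod_cast this.symm
    · have := hs k
      omega
  · intro h
    have h1 := single 1
    rw [one_smul] at h1
    have := key _ _ (hsub.symm.trans (h.trans h1)) k
    simp only [hkj, if_false, sub_zero] at this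
    linarith

theorem rho_simple (D : RootSystemData E) (j : Fin D.r) :
    ⟪D.ρ, D.α j⟫ = ⟪D.α j, D.α j⟫ / 2 := by
  classical
  obtain ⟨P, hP, hρ⟩ := D.ρ_def
  have ha : ⟪D.α j, D.α j⟫ ≠ 0 := by
    simpa using D.nonzero _ (D.base_mem j)
  have hj : D.α j ∈ P := by
    refine (hP _).2 ⟨D.base_mem j, fun i => if i = j then 1 else 0, ?_⟩
    simp [ite_smul]
  have hneg : ∀ β : E, ⟪β - (2 * ⟪β, D.α j⟫ / ⟪D.α j, D.α j⟫) • D.α j, D.α j⟫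
      = -⟪β, D.α j⟫ := by
    intro β
    rw [inner_sub_left, real_inner_smul_left]
    field_simp
    ring
  have hsum : ∑ β ∈ P.erase (D.α j), ⟪β, D.α j⟫ = 0 := by
    refine Finset.sum_involution
      (fun β _ => β - (2 * ⟪β, D.α j⟫ / ⟪D.α j, D.α j⟫) • D.α j) ?_ ?_ ?_ ?_
    · intro β _
      rw [hneg]; ring
    · intro β _ h0 h
      have := hneg β
      rw [h] at this
      apply h0; linarith
    · intro β hβ
      obtain ⟨hne, hβP⟩ := Finset.mem_erase.1 hβ
      obtain ⟨hβΦ, hc⟩ := (hP _).1 hβP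
      have hm := D.reflect_mem _ (D.base_mem j) _ hβΦ
      obtain ⟨h1, h2⟩ := pos_reflect D j β hβΦ hc hne _ hm
      exact Finset.mem_erase.2 ⟨h2, (hP _).2 ⟨hm, h1⟩⟩
    · intro β _
      simp only [hneg]
      rw [mul_neg, neg_div, neg_smul]
      abel
  rw [hρ, real_inner_smul_left, sum_inner, ← Finset.add_sum_erase _ _ hj, hsum]
  ring

theorem weyl_isometry (D : RootSystemData E) (τ : E ≃ₗ[ℝ] E) (hτ : τ ∈ weylGroup D) :
    ∀ x y, ⟪τ x, τ y⟫ = ⟪x, y⟫ := by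
  unfold weylGroup at hτ
  induction hτ using Subgroup.closure_induction with
  | mem f hf =>
    obtain ⟨β, hβ, hf⟩ := hf
    intro x y
    have ha : ⟪β, β⟫ ≠ 0 := by simpa using D.nonzero _ hβ
    rw [hf, hf]
    simp only [inner_sub_left, inner_sub_right, real_inner_smul_left, real_inner_smul_right]
    rw [real_inner_comm β y]
    field_simp
    ring
  | one => intro x y; rfl
  | mul a b _ _ ha hb => intro x y; rw [LinearEquiv.mul_apply, LinearEquiv.mul_apply, ha, hb]
  | inv a _ ha =>
    intro x y
    rw [← ha]
    have h : ∀ z, a (a⁻¹ z) = z := fun z => a.apply_symm_apply z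
    rw [h, h]

theorem ext_base (D : RootSystemData E) (f g : E →ₗ[ℝ] ℝ) (h : ∀ j, f (D.α j) = g (D.α j)) :
    f = g := by
  refine LinearMap.ext_on D.base_spans ?_
  rintro _ ⟨j, rfl⟩
  exact h j

/-- `(ρ, γ − τᵢ(γ)) = h (λᵢ, γ)` for all `γ`; equivalently `ρ − τᵢ⁻¹(ρ) = h λᵢ`, and
moreover `ρ − τᵢ(ρ) = h λᵢ`, where `h = (ρ,θ) + 1` is the dual Coxeter number. -/
theorem statement4 (D : RootSystemData E)
    (i : Fin D.r) (hlong : ⟪D.α i, D.α i⟫ = 2) (hθ1 : ⟪D.fw i, D.θ⟫ = 1)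
    (τ : E ≃ₗ[ℝ] E) (hτW : τ ∈ weylGroup D)
    (hτi : τ (D.α i) = -D.θ)
    (hτj : ∀ j, j ≠ i → ∃ j', j' ≠ i ∧ τ (D.α j) = D.α j')
 :
    (∀ γ : E, ⟪D.ρ, γ - τ γ⟫ = (⟪D.ρ, D.θ⟫ + 1) * ⟪D.fw i, γ⟫) ∧
      D.ρ - τ.symm D.ρ = (⟪D.ρ, D.θ⟫ + 1) • D.fw i ∧
      D.ρ - τ D.ρ = (⟪D.ρ, D.θ⟫ + 1) • D.fw i := by
  have iso := weyl_isometry D τ hτW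
  have h1 : ∀ γ : E, ⟪D.ρ, γ - τ γ⟫ = (⟪D.ρ, D.θ⟫ + 1) * ⟪D.fw i, γ⟫ := by
    intro γ
    have := ext_base D ((innerₛₗ ℝ D.ρ) ∘ₗ (LinearMap.id - τ.toLinearMap))
      ((⟪D.ρ, D.θ⟫ + 1) • innerₛₗ ℝ (D.fw i)) (by
        intro j
        simp only [LinearMap.comp_apply, LinearMap.sub_apply, LinearMap.id_apply,
          LinearMap.smul_apply, innerₛₗ_apply_apply, LinearEquiv.coe_coe, smul_eq_mul]
        rw [D.fw_def]
        by_cases hj : j = i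
        · subst hj
          rw [hτi, sub_neg_eq_add, inner_add_right, rho_simple, if_pos rfl, hlong]
          ring
        · obtain ⟨j', -, hj'⟩ := hτj j hj
          have hn := iso (D.α j) (D.α j)
          rw [hj'] at hn
          rw [hj', inner_sub_right, rho_simple, rho_simple, hn, if_neg (Ne.symm hj)]
          ring)
    exact LinearMap.congr_fun this γ
  have h2 : D.ρ - τ.symm D.ρ = (⟪D.ρ, D.θ⟫ + 1) • D.fw i := by
    refine ext_inner_right ℝ fun γ => ?_
    rw [real_inner_smul_left, ← h1, inner_sub_left, inner_sub_right, ← iso (τ.symm D.ρ) γ,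
      τ.apply_symm_apply]
  have h3 : τ (D.fw i) = -D.fw i := by
    refine ext_inner_right ℝ fun γ => ?_
    have := ext_base D ((innerₛₗ ℝ (τ (D.fw i))) ∘ₗ τ.toLinearMap)
      ((innerₛₗ ℝ (-D.fw i)) ∘ₗ τ.toLinearMap) (by
        intro j
        simp only [LinearMap.comp_apply, innerₛₗ_apply_apply, LinearEquiv.coe_coe]
        rw [iso, D.fw_def]
        by_cases hj : j = i
        · subst hj
          rw [hτi, inner_neg_neg, hθ1, if_pos rfl, hlong]
          norm_num
        · obtain ⟨j', hne, hj'⟩ := hτj j hj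
          rw [hj', inner_neg_left, D.fw_def, if_neg (Ne.symm hj), if_neg (Ne.symm hne), neg_zero])
    have h := LinearMap.congr_fun this (τ.symm γ)
    simpa using h
  refine ⟨h1, h2, ?_⟩
  have h4 := congrArg τ h2
  rw [map_sub, map_smul, h3, τ.apply_symm_apply, smul_neg] at h4
  rw [← neg_sub, h4, neg_neg]
end
end

section
/- Let A = {x ∈ E : (x + ρ, α_j) > 0 for all 1 ≤ j ≤ r and (x, θ) < k + 1} (the open alcove). If λ ∈ A, μ ∈ E with μ ∉ A, and σ ∈ W₀ satisfies σ(μ) ∈ A, then ‖λ − σ(μ)‖ < ‖λ − μ‖. -/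
open scoped RealInnerProductSpace

noncomputable section

variable {E : Type} [NormedAddCommGroup E] [InnerProductSpace ℝ E] [FiniteDimensional ℝ E]

/-- The quantum Weyl group at level `k`: the group of affine isometries of `E` generated
by the affine reflections `x ↦ x - (2(x+ρ,αⱼ)/(αⱼ,αⱼ))αⱼ` and `x ↦ x - ((x,θ)-(k+1))θ`. -/
def qWeylGroup (D : RootSystemData E) (k : ℕ) : Subgroup (E ≃ᵃⁱ[ℝ] E) :=
  Subgroup.closure
    ({f | ∃ j : Fin D.r, ∀ x, f x = x - (2 * ⟪x + D.ρ, D.α j⟫ / ⟪D.α j, D.α j⟫) • D.α j} ∪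
     {f | ∀ x, f x = x - (⟪x, D.θ⟫ - (k + 1)) • D.θ})

namespace QW

/-- linear part of reflections -/
def lin (γ v : E) : E := v - (2 * ⟪v, γ⟫ / ⟪γ, γ⟫) • γ

/-- evaluation of an affine root, in shifted coordinates -/
def ev (ρ : E) (N : ℝ) (b : E × ℤ) (y : E) : ℝ := ⟪y + ρ, b.1⟫ + b.2 * N

/-- the affine reflection of an affine root -/
def rf (ρ : E) (N : ℝ) (b : E × ℤ) (y : E) : E := y - (2 * ev ρ N b y / ⟪b.1, b.1⟫) • b.1

theorem lin_self {γ : E} (h : γ ≠ 0) : lin γ γ = -γ := by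
  have : ⟪γ, γ⟫ ≠ 0 := by simpa using h
  unfold lin
  rw [mul_div_assoc, div_self this]
  module

theorem inner_lin (γ u v : E) : ⟪u, lin γ v⟫ = ⟪u, v⟫ - 2 * ⟪v, γ⟫ / ⟪γ, γ⟫ * ⟪u, γ⟫ := by
  simp [lin, inner_sub_right, inner_smul_right]

theorem inner_lin_lin {γ : E} (h : γ ≠ 0) (v : E) : ⟪lin γ v, lin γ v⟫ = ⟪v, v⟫ := by
  have : ⟪γ, γ⟫ ≠ 0 := by simpa using h
  simp only [lin, inner_sub_right, inner_sub_left, inner_smul_right, inner_smul_left,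
    real_inner_comm γ v]
  simp only [conj_trivial]
  field_simp
  ring

theorem lin_lin {γ : E} (h : γ ≠ 0) (v : E) : lin γ (lin γ v) = v := by
  have h' : ⟪γ, γ⟫ ≠ 0 := by simpa using h
  have : ⟪lin γ v, γ⟫ = - ⟪v, γ⟫ := by
    simp only [lin, inner_sub_left, inner_smul_left]
    simp
    field_simp
    ring
  rw [lin, this, lin]
  module

theorem ev_rf (ρ : E) (N : ℝ) (a b : E × ℤ) (n : ℤ) (hn : 2 * ⟪b.1, a.1⟫ / ⟪a.1, a.1⟫ = n) (y : E) :
    ev ρ N (lin a.1 b.1, b.2 - n * a.2) y = ev ρ N b (rf ρ N a y) := by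
  have e : rf ρ N a y + ρ = (y + ρ) - (2 * ev ρ N a y / ⟪a.1, a.1⟫) • a.1 := by
    unfold rf; abel
  simp only [ev, e] at *
  rw [inner_lin, hn, inner_sub_left, inner_smul_left, real_inner_comm b.1 a.1]
  push_cast
  rw [← hn]
  simp
  ring

theorem rf_rf (ρ : E) (N : ℝ) (a b : E × ℤ) (n : ℤ) (ha : a.1 ≠ 0)
    (hn : 2 * ⟪b.1, a.1⟫ / ⟪a.1, a.1⟫ = n) (y : E) :
    rf ρ N b (rf ρ N a y) = rf ρ N a (rf ρ N (lin a.1 b.1, b.2 - n * a.2) y) := by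
  have key : ∀ (t : ℝ) (v : E), rf ρ N a (y - t • v) = rf ρ N a y - t • lin a.1 v := by
    intro t v
    simp only [rf, ev, lin, inner_sub_left, inner_add_left, inner_smul_left]
    simp only [conj_trivial]
    match_scalars <;> ring
  conv_rhs => rw [rf.eq_def ρ N (lin a.1 b.1, b.2 - n * a.2) y]
  rw [key, ev_rf ρ N a b n hn]
  simp only [lin_lin ha, inner_lin_lin ha]
  rfl

theorem ev_self (ρ : E) (N : ℝ) (a : E × ℤ) (ha : a.1 ≠ 0) (y : E) :
    ev ρ N a (rf ρ N a y) = - ev ρ N a y := by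
  have h' : ⟪a.1, a.1⟫ ≠ 0 := by simpa using ha
  have e : rf ρ N a y + ρ = (y + ρ) - (2 * ev ρ N a y / ⟪a.1, a.1⟫) • a.1 := by
    unfold rf; abel
  rw [ev, e, inner_sub_left, inner_smul_left, conj_trivial, div_mul_cancel₀ _ h']
  unfold ev; ring

theorem rf_invol (ρ : E) (N : ℝ) (a : E × ℤ) (ha : a.1 ≠ 0) (y : E) :
    rf ρ N a (rf ρ N a y) = y := by
  rw [rf, ev_self ρ N a ha, rf]
  module

theorem dist_rf (ρ : E) (N : ℝ) (a : E × ℤ) (ha : a.1 ≠ 0) (x y : E)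
    (hx : 0 < ev ρ N a x) (hy : 0 < ev ρ N a y) : ‖x - y‖ < ‖x - rf ρ N a y‖ := by
  have h' : 0 < ⟪a.1, a.1⟫ := by
    rw [real_inner_self_eq_norm_sq]; have := norm_pos_iff.2 ha; positivity
  have e : x - rf ρ N a y = (x - y) + (2 * ev ρ N a y / ⟪a.1, a.1⟫) • a.1 := by
    unfold rf; abel
  have hd : ⟪x - y, a.1⟫ = ev ρ N a x - ev ρ N a y := by
    simp only [ev, inner_add_left, inner_sub_left]; ring
  have : ‖x - rf ρ N a y‖ ^ 2 = ‖x - y‖ ^ 2 + 4 * ev ρ N a x * ev ρ N a y / ⟪a.1, a.1⟫ := by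
    rw [e, norm_add_sq_real, inner_smul_right, hd, norm_smul, mul_pow,
      ← real_inner_self_eq_norm_sq a.1, Real.norm_eq_abs, sq_abs]
    field_simp
    ring
  have p : 0 < 4 * ev ρ N a x * ev ρ N a y / ⟪a.1, a.1⟫ := by positivity
  exact lt_of_pow_lt_pow_left₀ 2 (norm_nonneg _) (by linarith)

section
variable (D : RootSystemData E)

/-- strictly dominant vector -/
def Dom (v : E) : Prop := ∀ j, 0 < ⟪v, D.α j⟫

/-- simple affine roots -/
def sim : Option (Fin D.r) → E × ℤ
  | none => (-D.θ, 1)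
  | some j => (D.α j, 0)

theorem lin_mem {β γ : E} (hβ : β ∈ D.Φ) (hγ : γ ∈ D.Φ) : lin β γ ∈ D.Φ :=
  D.reflect_mem β hβ γ hγ

theorem neg_mem {β : E} (hβ : β ∈ D.Φ) : -β ∈ D.Φ := by
  rw [← lin_self (D.nonzero β hβ)]; exact lin_mem D hβ hβ

theorem sim_mem (i) : (sim D i).1 ∈ D.Φ := by
  cases i with
  | none => exact neg_mem D D.θ_mem
  | some j => exact D.base_mem j

theorem sub_nonneg_of {u β : E} (hu : ∀ j, 0 ≤ ⟪u, D.α j⟫) (hβ : β ∈ D.Φ) :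
    ⟪u, β⟫ ≤ ⟪u, D.θ⟫ := by
  obtain ⟨c, hc, e⟩ := D.θ_highest β hβ
  have : 0 ≤ ⟪u, D.θ - β⟫ := by
    rw [e, inner_sum]
    refine Finset.sum_nonneg fun i _ => ?_
    rw [inner_smul_right]; exact mul_nonneg (hc i) (hu i)
  rw [inner_sub_right] at this; linarith

theorem coeffs_pos {v β : E} (hv : Dom D v) (hβ : β ∈ D.Φ) (h : 0 ≤ ⟪v, β⟫) :
    ∃ c : Fin D.r → ℤ, β = ∑ i, (c i : ℝ) • D.α i ∧ (∀ i, 0 ≤ c i) := by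
  obtain ⟨c, e, hc | hc⟩ := D.base_coeffs β hβ
  · exact ⟨c, e, hc⟩
  · exfalso
    have hle : ∀ i ∈ Finset.univ, (c i : ℝ) * ⟪v, D.α i⟫ ≤ 0 := fun i _ =>
      mul_nonpos_of_nonpos_of_nonneg (by exact_mod_cast hc i) (hv i).le
    have hs : ⟪v, β⟫ = ∑ i, (c i : ℝ) * ⟪v, D.α i⟫ := by
      rw [e, inner_sum]; simp [inner_smul_right]
    have h0 : ∑ i, (c i : ℝ) * ⟪v, D.α i⟫ = 0 := le_antisymm (Finset.sum_nonpos hle) (hs ▸ h)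
    have := (Finset.sum_eq_zero_iff_of_nonpos hle).1 h0
    apply D.nonzero β hβ
    rw [e]
    refine Finset.sum_eq_zero fun i hi => ?_
    have := this i hi
    rcases mul_eq_zero.1 this with h | h
    · rw [h, zero_smul]
    · exact absurd h (hv i).ne'

theorem root_ne {v β : E} (hv : Dom D v) (hβ : β ∈ D.Φ) : ⟪v, β⟫ ≠ 0 := by
  intro h
  obtain ⟨c, e, hc⟩ := coeffs_pos D hv hβ h.ge
  obtain ⟨d, e', hd⟩ := coeffs_pos D hv (neg_mem D hβ) (by rw [inner_neg_right, h]; simp)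
  have hle : ∀ i ∈ Finset.univ, 0 ≤ (c i : ℝ) * ⟪v, D.α i⟫ := fun i _ =>
      mul_nonneg (by exact_mod_cast hc i) (hv i).le
  have hs : ⟪v, β⟫ = ∑ i, (c i : ℝ) * ⟪v, D.α i⟫ := by
    rw [e, inner_sum]; simp [inner_smul_right]
  have := (Finset.sum_eq_zero_iff_of_nonneg hle).1 (hs ▸ h)
  apply D.nonzero β hβ
  rw [e]
  refine Finset.sum_eq_zero fun i hi => ?_
  rcases mul_eq_zero.1 (this i hi) with h | h
  · rw [h, zero_smul]
  · exact absurd h (hv i).ne'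

theorem root_le {v β : E} (hv : Dom D v) (hβ : β ∈ D.Φ) : ⟪v, β⟫ ≤ ⟪v, D.θ⟫ :=
  sub_nonneg_of D (fun j => (hv j).le) hβ

theorem ip_pos (j) : 0 < ⟪D.α j, D.α j⟫ := by
  rw [real_inner_self_eq_norm_sq]
  have := norm_pos_iff.2 (D.nonzero _ (D.base_mem j)); positivity

theorem theta_dom {v : E} (hv : Dom D v) (j) : 0 ≤ ⟪D.θ, D.α j⟫ := by
  have h := root_le D hv (lin_mem D (D.base_mem j) D.θ_mem)
  rw [inner_lin] at h
  by_contra! hc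
  have : 2 * ⟪D.θ, D.α j⟫ / ⟪D.α j, D.α j⟫ < 0 := div_neg_of_neg_of_pos (by linarith) (ip_pos D j)
  nlinarith [hv j, mul_pos_of_neg_of_neg this (neg_lt_zero.2 (hv j))]

theorem theta_long {v : E} (hv : Dom D v) : ⟪D.θ, D.θ⟫ = 2 := by
  classical
  refine le_antisymm (D.long_le _ D.θ_mem) ?_
  obtain ⟨β0, hβ0, h0⟩ := D.long_exists
  obtain ⟨β, hβ, hmax⟩ := (D.Φ.filter (fun β => ⟪β, β⟫ = 2)).exists_max_image (fun β => ⟪v, β⟫)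
    ⟨β0, Finset.mem_filter.2 ⟨hβ0, h0⟩⟩
  simp only [Finset.mem_filter] at hβ hmax
  have hd : ∀ j, 0 ≤ ⟪β, D.α j⟫ := by
    intro j
    have h := hmax (lin (D.α j) β) ⟨lin_mem D (D.base_mem j) hβ.1, by
      rw [inner_lin_lin (D.nonzero _ (D.base_mem j)), hβ.2]⟩
    rw [inner_lin] at h
    by_contra! hc
    have : 2 * ⟪β, D.α j⟫ / ⟪D.α j, D.α j⟫ < 0 := div_neg_of_neg_of_pos (by linarith) (ip_pos D j)
    nlinarith [hv j, mul_pos_of_neg_of_neg this (neg_lt_zero.2 (hv j))]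
  have h1 := sub_nonneg_of D hd hβ.1
  have h2 := sub_nonneg_of D (theta_dom D hv) hβ.1
  rw [real_inner_comm] at h2
  linarith [hβ.2]

variable {D}

/-- sign of affine roots on the alcove -/
theorem ev_pos {N : ℝ} {z : E} (hv : Dom D (z + D.ρ)) (hN : ⟪z + D.ρ, D.θ⟫ < N)
    {b : E × ℤ} (hb : b.1 ∈ D.Φ) :
    0 < ev D.ρ N b z ↔ (1 ≤ b.2 ∨ b.2 = 0 ∧ 0 < ⟪z + D.ρ, b.1⟫) := by
  have h1 := root_le D hv hb
  have h2 := root_le D hv (neg_mem D hb)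
  rw [inner_neg_right] at h2
  have hN0 : 0 < N := by linarith
  unfold ev
  rcases lt_trichotomy b.2 0 with h | h | h
  · have : (b.2 : ℝ) ≤ -1 := by exact_mod_cast (by omega : b.2 ≤ -1)
    constructor
    · intro; nlinarith
    · rintro (h' | h') <;> omega
  · simp [h]
  · have : (1 : ℝ) ≤ b.2 := by exact_mod_cast h
    constructor
    · intro; left; omega
    · intro; nlinarith

theorem ev_ne {N : ℝ} {z : E} (hv : Dom D (z + D.ρ)) (hN : ⟪z + D.ρ, D.θ⟫ < N)
    {b : E × ℤ} (hb : b.1 ∈ D.Φ) : ev D.ρ N b z ≠ 0 := by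
  have h1 := root_le D hv hb
  have h2 := root_le D hv (neg_mem D hb)
  rw [inner_neg_right] at h2
  have h3 := root_ne D hv hb
  unfold ev
  intro h0
  rcases lt_trichotomy b.2 0 with h | h | h
  · have : (b.2 : ℝ) ≤ -1 := by exact_mod_cast (by omega : b.2 ≤ -1)
    nlinarith
  · simp [h] at h0; exact h3 (by simpa using h0)
  · have : (1 : ℝ) ≤ b.2 := by exact_mod_cast h
    nlinarith

theorem key {N : ℝ} {z : E} (hv : Dom D (z + D.ρ)) (hN : ⟪z + D.ρ, D.θ⟫ < N)
    {b : E × ℤ} (hb : b.1 ∈ D.Φ) (hp : 0 < ev D.ρ N b z) (i : Option (Fin D.r))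
    (hn : ¬ 0 < ev D.ρ N b (rf D.ρ N (sim D i) z)) : b = sim D i := by
  obtain ⟨n, hn'⟩ := D.integral _ (sim_mem D i) _ hb
  rw [← ev_rf D.ρ N (sim D i) b n hn', ev_pos hv hN (lin_mem D (sim_mem D i) hb)] at hn
  rw [ev_pos hv hN hb] at hp
  push Not at hn
  obtain ⟨hn1, hn2⟩ := hn
  cases i with
  | some j =>
    simp only [sim, mul_zero, sub_zero] at *
    have hb0 : b.2 = 0 := by omega
    have hpos : 0 < ⟪z + D.ρ, b.1⟫ := by
      rcases hp with h | h
      · omega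
      · exact h.2
    have hneg := hn2 hb0
    obtain ⟨c, e, hc⟩ := coeffs_pos D hv hb hpos.le
    obtain ⟨d, e', hd⟩ := coeffs_pos D hv (neg_mem D (lin_mem D (D.base_mem j) hb))
      (by rw [inner_neg_right]; linarith)
    have hc0 : ∀ i, i ≠ j → c i = 0 := by
      intro i hij
      have hsum : ∑ i, ((c i : ℝ) + d i - if i = j then (n : ℝ) else 0) • D.α i = 0 := by
        simp only [sub_smul, add_smul, Finset.sum_sub_distrib, Finset.sum_add_distrib, ← e, ← e',
          ite_smul, zero_smul, Finset.sum_ite_eq', Finset.mem_univ, if_true]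
        simp only [lin, hn']
        abel
      have := Fintype.linearIndependent_iff.1 D.base_indep _ hsum i
      simp only [hij, if_false, sub_zero] at this
      have h3 : c i + d i = 0 := by exact_mod_cast this
      have := hc i; have := hd i; omega
    have e2 : b.1 = (c j : ℝ) • D.α j := by
      rw [e]
      exact Finset.sum_eq_single j (fun i _ h => by simp [hc0 i h]) (by simp)
    have hr := D.reduced (D.α j) (D.base_mem j) (c j) (e2 ▸ hb)
    rcases hr with h | h
    · ext1
      · rw [e2, h, one_smul]
      · exact hb0
    · have : (0 : ℝ) ≤ c j := by exact_mod_cast hc j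
      linarith
  | none =>
    have hθ := theta_long D hv
    simp only [sim, mul_one, inner_neg_right, inner_neg_left, neg_neg, hθ] at hn' hn1 hn2 ⊢
    have hq : ⟪b.1, D.θ⟫ = -n := by linarith
    have hl : lin (-D.θ) b.1 = b.1 + (n : ℝ) • D.θ := by
      simp only [lin, inner_neg_right, inner_neg_left, neg_neg, hθ, hq]
      module
    rw [hl] at hn2
    have hT : 0 < ⟪z + D.ρ, D.θ⟫ := by
      have h1 := root_le D hv (neg_mem D D.θ_mem)
      rw [inner_neg_right] at h1
      exact lt_of_le_of_ne (by linarith) (root_ne D hv D.θ_mem).symm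
    rcases hp with h | ⟨h, hp⟩
    · rcases lt_trichotomy n 1 with h1 | h1 | h1
      · omega
      · exfalso
        have h3 := hn2 (by omega)
        have h4 := root_le D hv (neg_mem D hb)
        have h5 := root_ne D hv (lin_mem D (neg_mem D D.θ_mem) hb)
        rw [hl] at h5
        simp only [h1, Int.cast_one, one_smul, inner_add_right, inner_neg_right] at *
        exact h5 (by linarith)
      · have hnR : (2 : ℝ) ≤ n := by exact_mod_cast h1
        have h6 : ⟪b.1 + D.θ, b.1 + D.θ⟫ ≤ 0 := by
          rw [inner_add_left, inner_add_right, inner_add_right, real_inner_comm b.1 D.θ, hq, hθ]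
          linarith [D.long_le _ hb]
        have h7 : b.1 + D.θ = 0 := real_inner_self_nonpos.1 h6
        have h8 : b.1 = -D.θ := eq_neg_of_add_eq_zero_left h7
        rw [h8, inner_neg_left, hθ] at hq
        have hn2' : n = 2 := by
          have : (n : ℝ) = 2 := by linarith
          exact_mod_cast this
        have : b.2 ≠ 2 := by
          intro hb2
          have := hn2 (by omega)
          rw [h8, hn2'] at this
          simp only [inner_add_right, inner_neg_right, inner_smul_right] at this
          push_cast at this
          linarith
        ext1
        · exact h8
        · show b.2 = 1
          omega
    · exfalso
      obtain ⟨c, e, hc⟩ := coeffs_pos D hv hb hp.le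
      have : 0 ≤ ⟪D.θ, b.1⟫ := by
        rw [e, inner_sum]
        refine Finset.sum_nonneg fun i _ => ?_
        rw [inner_smul_right]
        exact mul_nonneg (by exact_mod_cast hc i) (theta_dom D hv i)
      rw [real_inner_comm, hq] at this
      have hn0 : n ≤ 0 := by
        have : (n : ℝ) ≤ 0 := by linarith
        exact_mod_cast this
      have : n = 0 := by omega
      have h3 := hn2 (by omega)
      simp [this] at h3
      linarith

variable (D) in
/-- the action of a word -/
def wd (N : ℝ) : List (Option (Fin D.r)) → E → E
  | [], y => y
  | i :: L, y => rf D.ρ N (sim D i) (wd N L y)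

theorem wd_append (N : ℝ) (L M : List (Option (Fin D.r))) (y : E) :
    wd D N (L ++ M) y = wd D N L (wd D N M y) := by
  induction L with
  | nil => rfl
  | cons i L ih => simp [wd, ih]

theorem wd_reverse (N : ℝ) (L : List (Option (Fin D.r))) (y : E) :
    wd D N L.reverse (wd D N L y) = y := by
  induction L generalizing y with
  | nil => rfl
  | cons i L ih =>
    simp only [List.reverse_cons, wd_append, wd]
    rw [rf_invol _ _ _ (D.nonzero _ (sim_mem D i)), ih]

theorem exchange {N : ℝ} {z : E} (hv : Dom D (z + D.ρ)) (hN : ⟪z + D.ρ, D.θ⟫ < N)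
    (L : List (Option (Fin D.r))) : ∀ (b : E × ℤ), b.1 ∈ D.Φ → 0 < ev D.ρ N b z →
    ev D.ρ N b (wd D N L z) < 0 →
    ∃ L' : List (Option (Fin D.r)), L'.length + 1 = L.length ∧
      ∀ y, rf D.ρ N b (wd D N L y) = wd D N L' y := by
  induction L with
  | nil => intro b _ h1 h2; simp only [wd] at h2; linarith
  | cons i L ih =>
    intro b hb h1 h2
    by_cases h : 0 < ev D.ρ N b (rf D.ρ N (sim D i) z)
    · obtain ⟨n, hn⟩ := D.integral _ (sim_mem D i) _ hb
      have h0 := D.nonzero _ (sim_mem D i)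
      simp only [wd] at h2
      rw [← ev_rf D.ρ N (sim D i) b n hn] at h h2
      obtain ⟨L', hL, hL'⟩ := ih _ (lin_mem D (sim_mem D i) hb) h h2
      refine ⟨i :: L', by simp [hL], fun y => ?_⟩
      simp only [wd]
      rw [rf_rf D.ρ N (sim D i) b n h0 hn, hL']
    · refine ⟨L, rfl, fun y => ?_⟩
      rw [key hv hN hb h1 i h]
      exact rf_invol _ _ _ (D.nonzero _ (sim_mem D i)) _

theorem sim_pos {N : ℝ} {z : E} (hv : Dom D (z + D.ρ)) (hN : ⟪z + D.ρ, D.θ⟫ < N) (i) :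
    0 < ev D.ρ N (sim D i) z := by
  rw [ev_pos hv hN (sim_mem D i)]
  cases i with
  | none => left; exact le_rfl
  | some j => right; exact ⟨rfl, hv j⟩

theorem main {N : ℝ} {x z : E} (hv : Dom D (z + D.ρ)) (hN : ⟪z + D.ρ, D.θ⟫ < N)
    (hvx : Dom D (x + D.ρ)) (hNx : ⟪x + D.ρ, D.θ⟫ < N) :
    ∀ (n : ℕ) (L : List (Option (Fin D.r))), L.length = n →
      wd D N L z = z ∨ ‖x - z‖ < ‖x - wd D N L z‖ := by
  intro n
  induction n using Nat.strong_induction_on with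
  | _ n ih =>
    intro L hL
    cases L with
    | nil => left; rfl
    | cons i T =>
      simp only [List.length_cons] at hL
      have hT := ih T.length (by omega) T rfl
      rcases lt_trichotomy (ev D.ρ N (sim D i) (wd D N T z)) 0 with h | h | h
      · obtain ⟨L', h1, h2⟩ := exchange hv hN T _ (sim_mem D i) (sim_pos hv hN i) h
        have := ih L'.length (by omega) L' rfl
        rw [← h2 z] at this
        exact this
      · have : wd D N (i :: T) z = wd D N T z := by simp [wd, rf, h]
        rw [this]; exact hT
      · right
        have := dist_rf D.ρ N (sim D i) (D.nonzero _ (sim_mem D i)) x (wd D N T z)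
          (sim_pos hvx hNx i) h
        rcases hT with h' | h'
        · rw [h'] at this
          simpa only [wd, h'] using this
        · exact h'.trans this

theorem word {k : ℕ} {v : E} (hv : Dom D v) (σ : E ≃ᵃⁱ[ℝ] E) (hσ : σ ∈ qWeylGroup D k) :
    ∃ L, ∀ y, σ y = wd D (k + 1 + ⟪D.ρ, D.θ⟫) L y := by
  induction hσ using Subgroup.closure_induction with
  | mem f hf =>
    rcases hf with ⟨j, hj⟩ | hf
    · refine ⟨[some j], fun y => ?_⟩
      rw [hj]
      simp [wd, rf, sim, ev]
    · refine ⟨[none], fun y => ?_⟩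
      rw [hf]
      simp only [wd, rf, sim, ev, inner_neg_right, inner_neg_left, neg_neg, theta_long D hv,
        inner_add_left]
      push_cast
      module
  | one => exact ⟨[], fun y => rfl⟩
  | mul f g _ _ hf hg =>
    obtain ⟨L, hL⟩ := hf
    obtain ⟨M, hM⟩ := hg
    refine ⟨L ++ M, fun y => ?_⟩
    rw [wd_append, ← hM, ← hL]; rfl
  | inv f _ hf =>
    obtain ⟨L, hL⟩ := hf
    refine ⟨L.reverse, fun y => ?_⟩
    have h : f (f⁻¹ y) = y := f.apply_symm_apply y
    conv_rhs => rw [← h, hL, wd_reverse]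

end

end QW

/-- If `λ` lies in the open alcove `A`, `μ ∉ A`, and `σ ∈ W₀` satisfies `σ(μ) ∈ A`, then
`‖λ − σ(μ)‖ < ‖λ − μ‖`. -/
theorem statement6 (D : RootSystemData E) (k : ℕ) (hk : 0 < k) (A : Set E)
    (hA : A = {x : E | (∀ j, 0 < ⟪x + D.ρ, D.α j⟫) ∧ ⟪x, D.θ⟫ < k + 1})
    (lam μ : E) (hlam : lam ∈ A) (hμ : μ ∉ A)
    (σ : E ≃ᵃⁱ[ℝ] E) (hσ : σ ∈ qWeylGroup D k) (hσμ : σ μ ∈ A) :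
    ‖lam - σ μ‖ < ‖lam - μ‖ := by
  have hA' : ∀ x, x ∈ A ↔ QW.Dom D (x + D.ρ) ∧ ⟪x + D.ρ, D.θ⟫ < k + 1 + ⟪D.ρ, D.θ⟫ := by
    intro x
    rw [hA, inner_add_left, add_lt_add_iff_right]
    rfl
  obtain ⟨h1, h2⟩ := (hA' _).1 hlam
  obtain ⟨h3, h4⟩ := (hA' _).1 hσμ
  obtain ⟨L, hL⟩ := QW.word h1 σ⁻¹ (inv_mem hσ)
  have hm : σ⁻¹ (σ μ) = μ := σ.symm_apply_apply μ
  rw [hL] at hm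
  rcases QW.main h3 h4 h1 h2 _ L rfl with h | h
  · rw [hm] at h
    exact absurd (h ▸ hσμ) hμ
  · rwa [hm] at h
end
end

section
/- Let k ≥ 0 be a real number and let λ ∈ E satisfy (λ, α_j) ≥ 0 for all 1 ≤ j ≤ r (λ is dominant) and (λ, θ) ≤ k. Then for every root α ∈ Φ, |(λ + ρ, α)| ≤ k + h − 1; in particular |(λ + ρ, α)| < k + h. -/
open scoped RealInnerProductSpace

noncomputable section

variable {E : Type} [NormedAddCommGroup E] [InnerProductSpace ℝ E] [FiniteDimensional ℝ E]


/-- A simple reflection permutes the positive roots other than the simple root. -/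
lemma simple_reflection_pos (D : RootSystemData E) (j : Fin D.r) (β : E) (hβ : β ∈ D.Φ)
    (hpos : ∃ c : Fin D.r → ℕ, β = ∑ i, (c i : ℝ) • D.α i) (hne : β ≠ D.α j) (t : ℝ)
    (hs : β - t • D.α j ∈ D.Φ) :
    (∃ c : Fin D.r → ℕ, β - t • D.α j = ∑ i, (c i : ℝ) • D.α i) ∧ β - t • D.α j ≠ D.α j := by
  classical
  obtain ⟨c, hc⟩ := hpos
  have hex : ∃ i, i ≠ j ∧ 0 < c i := by
    by_contra hcon
    push Not at hcon
    have h1 : β = (c j : ℝ) • D.α j := by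
      rw [hc]
      refine Finset.sum_eq_single j ?_ (by simp)
      intro i _ hij
      have h0 : c i = 0 := Nat.le_zero.mp (hcon i hij)
      simp [h0]
    rcases D.reduced (D.α j) (D.base_mem j) (c j : ℝ) (h1 ▸ hβ) with h | h
    · apply hne
      rw [h1, h, one_smul]
    · have : (0 : ℝ) ≤ (c j : ℝ) := Nat.cast_nonneg _
      linarith
  obtain ⟨i, hij, hi⟩ := hex
  have key : ∀ d : Fin D.r → ℝ, β - t • D.α j = ∑ i, d i • D.α i → d i = c i := by
    intro d hd
    have h2 : ∑ l, (d l - c l + (if l = j then t else 0)) • D.α l = 0 := by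
      simp only [add_smul, sub_smul, Finset.sum_add_distrib, Finset.sum_sub_distrib, ite_smul,
        zero_smul, Finset.sum_ite_eq', Finset.mem_univ, if_true]
      rw [← hd, ← hc]
      abel
    have h3 := Fintype.linearIndependent_iff.mp D.base_indep _ h2 i
    simp only [hij, if_false] at h3
    linarith
  have hi' : (0 : ℝ) < c i := by exact_mod_cast hi
  constructor
  · obtain ⟨d, hd, hsign⟩ := D.base_coeffs _ hs
    have h4 := key (fun l => (d l : ℝ)) hd
    rcases hsign with h | h
    · refine ⟨fun l => (d l).toNat, ?_⟩
      rw [hd]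
      refine Finset.sum_congr rfl fun l _ => ?_
      have h5 : (((d l).toNat : ℤ) : ℝ) = (d l : ℝ) := by rw [Int.toNat_of_nonneg (h l)]
      rw [← h5, Int.cast_natCast]
    · have h6 : (d i : ℝ) ≤ 0 := by exact_mod_cast h i
      linarith
  · intro heq
    have h7 := key (fun l => if l = j then 1 else 0) (by rw [heq]; simp)
    simp only [hij, if_false] at h7
    linarith

/-- `ρ` is dominant. -/
lemma rho_dominant (D : RootSystemData E) (j : Fin D.r) : 0 ≤ ⟪D.ρ, D.α j⟫ := by
  classical
  obtain ⟨P, hP, hρ⟩ := D.ρ_def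
  have hα : ⟪D.α j, D.α j⟫ ≠ 0 := by
    simpa using D.nonzero _ (D.base_mem j)
  have hjP : D.α j ∈ P := by
    rw [hP]
    exact ⟨D.base_mem j, fun l => if l = j then 1 else 0, by simp⟩
  have hinv : ∀ β : E, ⟪β - (2 * ⟪β, D.α j⟫ / ⟪D.α j, D.α j⟫) • D.α j, D.α j⟫
      = - ⟪β, D.α j⟫ := by
    intro β
    rw [inner_sub_left, real_inner_smul_left]
    field_simp
    ring
  have hsum : ∑ β ∈ P.erase (D.α j), ⟪β, D.α j⟫ = 0 := by
    refine Finset.sum_involution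
      (fun β _ => β - (2 * ⟪β, D.α j⟫ / ⟪D.α j, D.α j⟫) • D.α j) ?_ ?_ ?_ ?_
    · intro β _
      simp only [hinv]
      ring
    · intro β _ h0 heq
      have h1 := hinv β
      rw [heq] at h1
      apply h0
      linarith
    · intro β hβ
      obtain ⟨hne, hβP⟩ := Finset.mem_erase.mp hβ
      obtain ⟨hβΦ, hpos⟩ := (hP β).mp hβP
      have hs := D.reflect_mem _ (D.base_mem j) _ hβΦ
      obtain ⟨h1, h2⟩ := simple_reflection_pos D j β hβΦ hpos hne _ hs
      exact Finset.mem_erase.mpr ⟨h2, (hP _).mpr ⟨hs, h1⟩⟩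
    · intro β _
      simp only [hinv]
      rw [mul_neg, neg_div, neg_smul]
      abel
  rw [hρ, real_inner_smul_left, sum_inner, ← Finset.add_sum_erase _ _ hjP, hsum]
  have := real_inner_self_nonneg (x := D.α j)
  linarith

/-- If `λ` is dominant with `(λ,θ) ≤ k` (`k ≥ 0`), then `|(λ+ρ,α)| ≤ k + h − 1 < k + h`
for every root `α`, where `h = (ρ,θ) + 1`. -/
theorem statement7 (D : RootSystemData E) (k : ℝ) (hk : 0 ≤ k) (lam : E)
    (hdom : ∀ j, 0 ≤ ⟪lam, D.α j⟫) (hlev : ⟪lam, D.θ⟫ ≤ k) :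
    ∀ β ∈ D.Φ, |⟪lam + D.ρ, β⟫| ≤ k + (⟪D.ρ, D.θ⟫ + 1) - 1 ∧
      |⟪lam + D.ρ, β⟫| < k + (⟪D.ρ, D.θ⟫ + 1) := by
  have hle : ∀ β ∈ D.Φ, ⟪lam + D.ρ, β⟫ ≤ k + ⟪D.ρ, D.θ⟫ := by
    intro β hβ
    obtain ⟨c, hc, hθ⟩ := D.θ_highest β hβ
    have h1 : 0 ≤ ⟪lam + D.ρ, D.θ - β⟫ := by
      rw [hθ, inner_sum]
      refine Finset.sum_nonneg fun i _ => ?_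
      rw [real_inner_smul_right, inner_add_left]
      exact mul_nonneg (hc i) (add_nonneg (hdom i) (rho_dominant D i))
    rw [inner_sub_right, inner_add_left lam D.ρ D.θ] at h1
    linarith
  intro β hβ
  have hneg : -β ∈ D.Φ := by
    have h0 : ⟪β, β⟫ ≠ 0 := by simpa using D.nonzero _ hβ
    have h := D.reflect_mem β hβ β hβ
    rw [mul_div_assoc, div_self h0, mul_one, two_smul] at h
    simpa using h
  have h1 := hle β hβ
  have h2 := hle _ hneg
  rw [inner_neg_right] at h2
  have h3 : |⟪lam + D.ρ, β⟫| ≤ k + ⟪D.ρ, D.θ⟫ := abs_le.mpr ⟨by linarith, h1⟩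
  exact ⟨by linarith, by linarith⟩
end
end

section
/- Let k be a positive integer and let Λ₀ = {λ ∈ Λ : (λ, α_j) ≥ 0 for all 1 ≤ j ≤ r and (λ, θ) ≤ k} (the Weyl alcove at level k). Then the map φ_i(γ) = kλ_i + τ_i(γ) restricts to a bijection of Λ₀ onto itself. -/
open scoped RealInnerProductSpace

noncomputable section

variable {E : Type} [NormedAddCommGroup E] [InnerProductSpace ℝ E] [FiniteDimensional ℝ E]

/-- The weight lattice `Λ = {x : 2(x,β)/(β,β) ∈ ℤ for all roots β}`. -/
def wtLattice (D : RootSystemData E) : AddSubgroup E where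
  carrier := {x | ∀ β ∈ D.Φ, ∃ n : ℤ, 2 * ⟪x, β⟫ / ⟪β, β⟫ = (n : ℝ)}
  zero_mem' := fun β _ => ⟨0, by simp⟩
  add_mem' := by
    intro a b ha hb β hβ
    obtain ⟨m, hm⟩ := ha β hβ
    obtain ⟨n, hn⟩ := hb β hβ
    refine ⟨m + n, ?_⟩
    rw [inner_add_left]
    push_cast
    rw [← hm, ← hn]
    ring
  neg_mem' := by
    intro a ha β hβ
    obtain ⟨m, hm⟩ := ha β hβ
    refine ⟨-m, ?_⟩
    rw [inner_neg_left]
    push_cast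
    rw [← hm]
    ring

/-- The root lattice: the subgroup of `ℤ`-linear combinations of roots. -/
def rootLattice (D : RootSystemData E) : AddSubgroup E :=
  AddSubgroup.closure (D.Φ : Set E)

theorem aux_weyl (D : RootSystemData E) (w : E ≃ₗ[ℝ] E) (hw : w ∈ weylGroup D) :
    (∀ x y, ⟪w x, w y⟫ = ⟪x, y⟫) ∧ ∀ β, β ∈ D.Φ ↔ w β ∈ D.Φ := by
  unfold weylGroup at hw
  induction hw using Subgroup.closure_induction with
  | mem f hf =>
    obtain ⟨β, hβ, hf⟩ := hf
    have hb : ⟪β, β⟫ ≠ 0 := by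
      simpa using D.nonzero β hβ
    constructor
    · intro x y
      rw [hf, hf]
      simp only [inner_sub_left, inner_sub_right, real_inner_smul_left, real_inner_smul_right]
      rw [real_inner_comm y β]
      field_simp
      ring
    · have hm : ∀ γ ∈ D.Φ, f γ ∈ D.Φ := fun γ hγ => by
        rw [hf]; exact D.reflect_mem β hβ γ hγ
      intro γ
      refine ⟨hm γ, fun h => ?_⟩
      have h2 := hm _ h
      have : f (f γ) = γ := by
        rw [hf (f γ), hf γ]
        simp only [inner_sub_left, real_inner_smul_left]
        rw [sub_sub, ← add_smul]
        have : 2 * ⟪γ, β⟫ / ⟪β, β⟫ +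
          2 * (⟪γ, β⟫ - 2 * ⟪γ, β⟫ / ⟪β, β⟫ * ⟪β, β⟫) / ⟪β, β⟫ = 0 := by
          field_simp
          ring
        rw [this]; simp
      rwa [this] at h2
  | one => simp
  | mul a b _ _ ha hb =>
    refine ⟨fun x y => ?_, fun β => ?_⟩
    · rw [LinearEquiv.mul_apply, LinearEquiv.mul_apply, ha.1, hb.1]
    · rw [LinearEquiv.mul_apply, ← ha.2, ← hb.2]
  | inv a _ ha =>
    have hinv : ∀ x, a (a⁻¹ x) = x := fun x => by
      rw [← LinearEquiv.mul_apply]; simp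
    refine ⟨fun x y => ?_, fun β => ?_⟩
    · rw [← ha.1, hinv, hinv]
    · rw [ha.2 (a⁻¹ β), hinv]

theorem aux_long (D : RootSystemData E) (β : E) (hβ : β ∈ D.Φ) :
    ∃ γ ∈ D.Φ, ⟪γ, γ⟫ = 2 ∧ ⟪γ, β⟫ ≠ 0 := by
  classical
  by_contra hcon
  push Not at hcon
  obtain ⟨l, hl, hl2⟩ := D.long_exists
  apply D.irred
  refine ⟨D.Φ.filter (fun b => ∀ γ ∈ D.Φ, ⟪γ, γ⟫ = 2 → ⟪γ, b⟫ = 0),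
    D.Φ.filter (fun b => ¬ ∀ γ ∈ D.Φ, ⟪γ, γ⟫ = 2 → ⟪γ, b⟫ = 0), ⟨β, ?_⟩, ⟨l, ?_⟩, ?_, ?_, ?_⟩
  · simp only [Finset.mem_filter]; exact ⟨hβ, hcon⟩
  · simp only [Finset.mem_filter]
    refine ⟨hl, fun h => ?_⟩
    have := h l hl hl2
    linarith
  · exact Finset.disjoint_filter_filter_not _ _ _
  · intro b
    simp only [Finset.mem_filter]
    tauto
  · intro a ha b hb
    simp only [Finset.mem_filter] at ha hb
    obtain ⟨ha, ha'⟩ := ha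
    obtain ⟨hb, hb'⟩ := hb
    push Not at hb'
    obtain ⟨γ, hγ, hγ2, hγb⟩ := hb'
    have hbb : ⟪b, b⟫ ≠ 0 := by
      simpa using D.nonzero b hb
    have h1 := D.reflect_mem b hb γ hγ
    have h2 : ⟪γ - (2 * ⟪γ, b⟫ / ⟪b, b⟫) • b, γ - (2 * ⟪γ, b⟫ / ⟪b, b⟫) • b⟫ = 2 := by
      simp only [inner_sub_left, inner_sub_right, real_inner_smul_left, real_inner_smul_right]
      rw [real_inner_comm γ b, hγ2]
      field_simp
      ring
    have h3 := ha' _ h1 h2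
    rw [inner_sub_left, ha' γ hγ hγ2, real_inner_smul_left] at h3
    rw [real_inner_comm]
    have h4 : (2 * ⟪γ, b⟫ / ⟪b, b⟫) ≠ 0 := by positivity
    have h5 : (2 * ⟪γ, b⟫ / ⟪b, b⟫) * ⟪b, a⟫ = 0 := by linarith
    exact (mul_eq_zero.mp h5).resolve_left h4

theorem aux_int (D : RootSystemData E) (β : E) (hβ : β ∈ D.Φ) :
    ∃ n : ℤ, 2 / ⟪β, β⟫ = (n : ℝ) := by
  obtain ⟨γ, hγ, hγ2, hne⟩ := aux_long D β hβ
  have hpos : 0 < ⟪β, β⟫ := real_inner_self_pos.mpr (D.nonzero β hβ)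
  have hle := D.long_le β hβ
  obtain ⟨n, hn⟩ := D.integral β hβ γ hγ
  obtain ⟨m, hm⟩ := D.integral γ hγ β hβ
  rw [hγ2, real_inner_comm] at hm
  have hm : ⟪γ, β⟫ = m := by linarith
  have hcs := real_inner_mul_inner_self_le γ β
  rw [hγ2, hm] at hcs
  rw [hm] at hn hne
  have hm0 : m ≠ 0 := by exact_mod_cast hne
  have h4 : (m : ℝ) * m ≤ 4 := by nlinarith
  have h4 : m * m ≤ 4 := by exact_mod_cast h4
  have hm2 : m ≤ 2 := by nlinarith
  have hm2' : -2 ≤ m := by nlinarith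
  have hfour : m * m = 4 → 2 / ⟪β, β⟫ = ((1 : ℤ) : ℝ) := by
    intro h
    have h' : (m : ℝ) * m = 4 := by exact_mod_cast h
    have : ⟪β, β⟫ = 2 := by linarith
    rw [this]; norm_num
  interval_cases m
  · exact ⟨1, hfour (by norm_num)⟩
  · refine ⟨-n, ?_⟩
    push_cast at hn ⊢
    rw [← hn]; ring
  · simp at hm0
  · refine ⟨n, ?_⟩
    push_cast at hn ⊢
    rw [← hn]; ring
  · exact ⟨1, hfour (by norm_num)⟩

theorem aux_fw (D : RootSystemData E) (i : Fin D.r) (hlong : ⟪D.α i, D.α i⟫ = 2)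
    (c : Fin D.r → ℝ) : ⟪D.fw i, ∑ j, c j • D.α j⟫ = c i := by
  rw [inner_sum]
  simp only [real_inner_smul_right, D.fw_def]
  simp only [mul_ite, mul_zero, Finset.sum_ite_eq, Finset.mem_univ, if_true, hlong]
  ring

theorem aux_fw_mem (D : RootSystemData E) (i : Fin D.r) (hlong : ⟪D.α i, D.α i⟫ = 2) :
    D.fw i ∈ wtLattice D := by
  intro β hβ
  obtain ⟨c, hc, -⟩ := D.base_coeffs β hβ
  obtain ⟨n, hn⟩ := aux_int D β hβ
  refine ⟨c i * n, ?_⟩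
  have : ⟪D.fw i, β⟫ = c i := by
    rw [hc]; exact aux_fw D i hlong (fun j => (c j : ℝ))
  rw [this]
  push_cast
  rw [← hn]; ring

theorem aux_wt (D : RootSystemData E) (w : E ≃ₗ[ℝ] E) (hw : w ∈ weylGroup D) (x : E)
    (hx : x ∈ wtLattice D) : w x ∈ wtLattice D := by
  obtain ⟨h1, h2⟩ := aux_weyl D w hw
  intro β hβ
  have hb : w (w.symm β) = β := w.apply_symm_apply β
  obtain ⟨n, hn⟩ := hx (w.symm β) (by rw [h2, hb]; exact hβ)
  refine ⟨n, ?_⟩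
  rw [← hn, ← h1 x, ← h1 (w.symm β), hb]

theorem aux_dom (D : RootSystemData E) (x : E) (hx : ∀ j, 0 ≤ ⟪x, D.α j⟫)
    (c : Fin D.r → ℝ) (hc : ∀ j, 0 ≤ c j) : 0 ≤ ⟪x, ∑ j, c j • D.α j⟫ := by
  rw [inner_sum]
  refine Finset.sum_nonneg fun j _ => ?_
  rw [real_inner_smul_right]
  exact mul_nonneg (hc j) (hx j)

/-- For a positive integer `k`, the map `φᵢ(γ) = kλᵢ + τᵢ(γ)` restricts to a bijection of
the Weyl alcove `Λ₀ = {λ ∈ Λ : (λ,αⱼ) ≥ 0 for all j, (λ,θ) ≤ k}` onto itself. -/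
theorem statement15 (D : RootSystemData E)
    (i : Fin D.r) (hlong : ⟪D.α i, D.α i⟫ = 2) (hθ1 : ⟪D.fw i, D.θ⟫ = 1)
    (τ : E ≃ₗ[ℝ] E) (hτW : τ ∈ weylGroup D)
    (hτi : τ (D.α i) = -D.θ)
    (hτj : ∀ j, j ≠ i → ∃ j', j' ≠ i ∧ τ (D.α j) = D.α j')
    (k : ℕ) (hk : 0 < k) :
    Set.BijOn (fun γ : E => (k : ℝ) • D.fw i + τ γ)
      {lam : E | lam ∈ wtLattice D ∧ (∀ j, 0 ≤ ⟪lam, D.α j⟫) ∧ ⟪lam, D.θ⟫ ≤ (k : ℝ)}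
      {lam : E | lam ∈ wtLattice D ∧ (∀ j, 0 ≤ ⟪lam, D.α j⟫) ∧ ⟪lam, D.θ⟫ ≤ (k : ℝ)} := by
  obtain ⟨hin, hΦ⟩ := aux_weyl D τ hτW
  have hkfw : (k : ℝ) • D.fw i ∈ wtLattice D := by
    rw [Nat.cast_smul_eq_nsmul]
    exact (wtLattice D).nsmul_mem (aux_fw_mem D i hlong) k
  have hnegΦ : ∀ β ∈ D.Φ, -β ∈ D.Φ := by
    intro β hβ
    have h := D.reflect_mem β hβ β hβ
    have hb : ⟪β, β⟫ ≠ 0 := by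
      simpa using D.nonzero β hβ
    rw [mul_div_assoc, div_self hb, mul_one, two_smul] at h
    convert h using 1
    abel
  have hsurj : ∀ j, j ≠ i → ∃ j', j' ≠ i ∧ τ (D.α j') = D.α j := by
    choose! σ hσ using hτj
    have hinj : Function.Injective (fun j : {j // j ≠ i} => (⟨σ j, (hσ j j.2).1⟩ : {j // j ≠ i})) := by
      intro a b hab
      simp only [Subtype.mk.injEq] at hab
      have : τ (D.α a) = τ (D.α b) := by
        rw [(hσ a a.2).2, (hσ b b.2).2, hab]
      exact Subtype.ext (D.base_indep.injective (τ.injective this))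
    intro j hj
    obtain ⟨j', hj'⟩ := Finite.surjective_of_injective hinj ⟨j, hj⟩
    refine ⟨j', j'.2, ?_⟩
    rw [(hσ j' j'.2).2]
    exact congrArg D.α (congrArg Subtype.val hj')
  refine ⟨?_, ?_, ?_⟩
  · rintro γ ⟨hγ, hdom, hθ⟩
    refine ⟨(wtLattice D).add_mem hkfw (aux_wt D τ hτW γ hγ), fun j => ?_, ?_⟩
    · rw [inner_add_left, real_inner_smul_left, D.fw_def]
      by_cases hj : j = i
      · subst hj
        have hβ : -(τ.symm (D.α j)) ∈ D.Φ := by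
          apply hnegΦ
          rw [hΦ, τ.apply_symm_apply]
          exact D.base_mem j
        obtain ⟨c, hc, hce⟩ := D.θ_highest _ hβ
        have h1 := aux_dom D γ hdom c hc
        rw [← hce, inner_sub_right, inner_neg_right, ← hin γ (τ.symm _), τ.apply_symm_apply] at h1
        simp only [if_true, hlong]
        linarith
      · obtain ⟨j', -, hj'⟩ := hsurj j hj
        rw [if_neg (Ne.symm hj), ← hj', hin]
        have := hdom j'
        linarith
    · have h1 : ⟪τ γ, D.θ⟫ = - ⟪γ, D.α i⟫ := by
        rw [← hin γ, hτi, inner_neg_right, neg_neg]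
      rw [inner_add_left, real_inner_smul_left, hθ1, h1]
      have := hdom i
      linarith
  · intro a _ b _ hab
    exact τ.injective (add_left_cancel hab)
  · rintro μ ⟨hμ, hdom, hθ⟩
    have hτs : τ (τ.symm (μ - (k : ℝ) • D.fw i)) = μ - (k : ℝ) • D.fw i := τ.apply_symm_apply _
    refine ⟨τ.symm (μ - (k : ℝ) • D.fw i), ⟨?_, fun j => ?_, ?_⟩, ?_⟩
    · exact aux_wt D τ⁻¹ ((weylGroup D).inv_mem hτW) _ ((wtLattice D).sub_mem hμ hkfw)
    · rw [← hin, hτs]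
      by_cases hj : j = i
      · subst hj
        rw [hτi, inner_neg_right, inner_sub_left, real_inner_smul_left, hθ1]
        linarith
      · obtain ⟨j', hj'i, hj'⟩ := hτj j hj
        rw [hj', inner_sub_left, real_inner_smul_left, D.fw_def, if_neg (Ne.symm hj'i)]
        have := hdom j'
        linarith
    · rw [← hin, hτs]
      have hfτ : ⟪D.fw i, τ D.θ⟫ = -1 := by
        obtain ⟨c, hc⟩ := D.θ_pos
        have hci : (c i : ℝ) = 1 := by
          rw [← hθ1, hc]; exact (aux_fw D i hlong (fun j => (c j : ℝ))).symm
        have : ∀ j, ⟪D.fw i, τ (D.α j)⟫ = if j = i then -1 else 0 := by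
          intro j
          split_ifs with hj
          · rw [hj, hτi, inner_neg_right, hθ1]
          · obtain ⟨j', hj'i, hj'⟩ := hτj j hj
            rw [hj', D.fw_def, if_neg (Ne.symm hj'i)]
        rw [hc, map_sum, inner_sum]
        simp only [map_smul, real_inner_smul_right, this]
        simp [hci]
      have hroot : τ D.θ ∈ D.Φ := (hΦ _).1 D.θ_mem
      obtain ⟨c, hc, hsgn⟩ := D.base_coeffs _ hroot
      have hci : (c i : ℝ) = -1 := by
        rw [← hfτ, hc]; exact (aux_fw D i hlong (fun j => (c j : ℝ))).symm
      have hci : c i = -1 := by exact_mod_cast hci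
      have hneg : ∀ j, c j ≤ 0 := by
        rcases hsgn with h | h
        · have := h i
          omega
        · exact h
      have h1 := aux_dom D μ hdom (fun j => -(c j : ℝ))
        (fun j => by have := hneg j; simpa using this)
      simp only [neg_smul, Finset.sum_neg_distrib] at h1
      rw [← hc, inner_neg_right] at h1
      rw [inner_sub_left, real_inner_smul_left, hfτ]
      linarith
    · simp only [hτs]
      abel
end
end
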